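/- arXiv:1103.2531 — 3 statements merged into one kernel-verified Lean document; each statement's English description precedes it below -/
import Mathlib

section
/- Let U be an open connected subset of the Riemann sphere ℂ̂ with ∞ ∉ U, and let K := ℂ̂ ∖ U, which is nonempty. Then K has finitely many connected components if and only if the following holds: for every family S of connected components of K such that both S and the family of remaining components are nonempty, there exists a Jordan loop γ with image contained in U such that no connected component of ℂ̂ ∖ γ '' [0,1] contains both a point of the union of the components in S and a point of the union of the remaining components of K. -/
open Set OnePoint

/-- A Jordan loop: a continuous map `γ : [0,1] → ℂ` with `γ 0 = γ 1` whose
restriction to `[0,1)` is injective. -/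
def IsJordanLoop (γ : ℝ → ℂ) : Prop :=
  ContinuousOn γ (Set.Icc 0 1) ∧ γ 0 = γ 1 ∧ Set.InjOn γ (Set.Ico 0 1)

/-- The set of connected components of a set `K` in the Riemann sphere. -/
def Components (K : Set (OnePoint ℂ)) : Set (Set (OnePoint ℂ)) :=
  {C | ∃ x ∈ K, C = connectedComponentIn K x}


lemma gr_reach_del {V : Type*} (G : SimpleGraph V) (hf : G.support.Finite) (hc : G.IsCycles)
    {v w : V} (h : G.Adj v w) : (G.deleteEdges {s(v, w)}).Reachable v w := by
  classical
  have : Finite G.support := hf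
  let H := G.induce G.support
  have hH : H.IsCycles := by
    intro x hx
    have h1 := hc (v := x.1) (by obtain ⟨y, hy⟩ := hx; exact ⟨y.1, hy⟩)
    rw [← h1, ← Set.ncard_image_of_injective _ (Subtype.val_injective)]
    congr 1
    ext y
    constructor
    · rintro ⟨z, hz, rfl⟩; exact hz
    · intro hy
      exact ⟨⟨y, x.1, G.adj_symm hy⟩, hy, rfl⟩
  have hv : v ∈ G.support := ⟨w, h⟩
  have hw : w ∈ G.support := ⟨v, h.symm⟩
  have h2 : (H.deleteEdges {s(⟨v, hv⟩, ⟨w, hw⟩)}).Reachable ⟨v, hv⟩ ⟨w, hw⟩ :=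
    SimpleGraph.IsCycles.reachable_deleteEdges (G := H) h hH
  let φ : (H.deleteEdges {s(⟨v, hv⟩, ⟨w, hw⟩)}) →g (G.deleteEdges {s(v, w)}) :=
    { toFun := Subtype.val
      map_rel' := by
        intro a b hab
        rw [SimpleGraph.deleteEdges_adj] at hab ⊢
        refine ⟨hab.1, fun hh => hab.2 ?_⟩
        simp only [mem_singleton_iff, Sym2.eq_iff, Subtype.ext_iff] at hh ⊢
        exact hh }
  exact h2.map φ

lemma gr_cycle {V : Type*} (G : SimpleGraph V) (hf : G.support.Finite) (hc : G.IsCycles)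
    {v w : V} (h : G.Adj v w) (hconn : ∀ x ∈ G.support, G.Reachable v x) :
    ∃ (n : ℕ) (p : ℕ → V), 3 ≤ n ∧ p n = p 0 ∧ (∀ i < n, ∀ j < n, p i = p j → i = j) ∧
      (∀ i < n, G.Adj (p i) (p (i+1))) ∧
      (∀ a b, G.Adj a b → ∃ i < n, (a = p i ∧ b = p (i+1)) ∨ (b = p i ∧ a = p (i+1))) := by
  classical
  obtain ⟨u, p, hp⟩ := SimpleGraph.adj_and_reachable_delete_edges_iff_exists_cycle.mp
    ⟨h, gr_reach_del G hf hc h⟩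
  have hvp : v ∈ p.support := SimpleGraph.Walk.fst_mem_support_of_mem_edges _ hp.2
  have key : ∀ x ∈ p.support, ∀ y, G.Adj x y → p.toSubgraph.Adj x y := by
    intro x hx y hxy
    have e1 := hp.1.ncard_neighborSet_toSubgraph_eq_two hx
    have e2 := hc ⟨y, hxy⟩
    have hfin : (G.neighborSet x).Finite := Set.finite_of_ncard_ne_zero (by omega)
    have := Set.eq_of_subset_of_ncard_le (p.toSubgraph.neighborSet_subset x) (by omega) hfin
    have h3 : y ∈ p.toSubgraph.neighborSet x := by rw [this]; exact hxy
    exact h3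
  have hall' : ∀ a x, G.Reachable a x → a ∈ p.support → x ∈ p.support := by
    intro a x ⟨q⟩
    induction q with
    | nil => exact id
    | @cons a b c hab q ih =>
      intro ha
      exact ih (p.mem_verts_toSubgraph.mp (p.toSubgraph.edge_vert (key a ha b hab).symm))
  have hall : ∀ x, G.Reachable v x → x ∈ p.support := fun x hx => hall' v x hx hvp
  refine ⟨p.length, p.getVert, hp.1.three_le_length, by simp, ?_, ?_, ?_⟩
  · intro i hi j hj hij
    exact hp.1.getVert_injOn' (by simp; omega) (by simp; omega) hij
  · intro i hi
    exact p.adj_getVert_succ hi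
  · intro a b hab
    have := key a (hall a (hconn a ⟨b, hab⟩)) b hab
    rw [SimpleGraph.Walk.toSubgraph_adj_iff] at this
    obtain ⟨i, hi, hi2⟩ := this
    refine ⟨i, hi2, ?_⟩
    rw [Sym2.eq_iff] at hi
    tauto

lemma gr_merge {V : Type*} (G G' : SimpleGraph V) (hf : G.support.Finite) (hc : G.IsCycles)
    {v p q s r : V} (hpq : G.Adj p q) (hsr : G.Adj s r) (hps : G'.Adj p s)
    (hGG : ∀ a b, G.Adj a b → s(a,b) ≠ s(p,q) → s(a,b) ≠ s(s,r) → G'.Adj a b)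
    (hp : G.Reachable v p) (hs : ¬ G.Reachable v s) :
    (∀ x, G.Reachable v x → G'.Reachable v x) ∧ G'.Reachable v s := by
  have hr : ¬ G.Reachable v r := fun h => hs (h.trans hsr.symm.reachable)
  -- a walk in G minus pq starting in the component stays valid in G'
  have step1 : ∀ x y, (G.deleteEdges {s(p,q)}).Reachable x y → G.Reachable v x → G'.Reachable x y := by
    intro x y ⟨w⟩
    induction w with
    | nil => intro _; exact SimpleGraph.Reachable.refl _
    | @cons a b c hab w ih =>
      intro ha
      rw [SimpleGraph.deleteEdges_adj] at hab
      have hb : G.Reachable v b := ha.trans hab.1.reachable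
      refine SimpleGraph.Reachable.trans (SimpleGraph.Adj.reachable ?_) (ih hb)
      refine hGG a b hab.1 hab.2 ?_
      intro h
      rw [Sym2.eq_iff] at h
      rcases h with ⟨rfl, rfl⟩ | ⟨rfl, rfl⟩
      · exact hs ha
      · exact hs hb
  have hpq' : G'.Reachable p q := step1 p q (gr_reach_del G hf hc hpq) hp
  have step2 : ∀ x y, G.Reachable x y → G.Reachable v x → G'.Reachable x y := by
    intro x y ⟨w⟩
    induction w with
    | nil => intro _; exact SimpleGraph.Reachable.refl _
    | @cons a b c hab w ih =>
      intro ha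
      have hb : G.Reachable v b := ha.trans hab.reachable
      refine SimpleGraph.Reachable.trans ?_ (ih hb)
      by_cases h : s(a,b) = s(p,q)
      · rw [Sym2.eq_iff] at h
        rcases h with ⟨rfl, rfl⟩ | ⟨rfl, rfl⟩
        · exact hpq'
        · exact hpq'.symm
      · refine (hGG a b hab h ?_).reachable
        intro h
        rw [Sym2.eq_iff] at h
        rcases h with ⟨rfl, rfl⟩ | ⟨rfl, rfl⟩
        · exact hs ha
        · exact hs hb
  have h3 : ∀ x, G.Reachable v x → G'.Reachable v x := fun x hx =>
    step2 v x hx (SimpleGraph.Reachable.refl _)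
  exact ⟨h3, (h3 p hp).trans hps.reachable⟩

/-- boundary graph of a coloring of the cells -/
def Gr (c : ℤ → ℤ → Bool) : SimpleGraph (ℤ × ℤ) where
  Adj p q := (q.1 = p.1 + 1 ∧ q.2 = p.2 ∧ c p.1 p.2 ≠ c p.1 (p.2 - 1)) ∨
    (p.1 = q.1 + 1 ∧ q.2 = p.2 ∧ c q.1 q.2 ≠ c q.1 (q.2 - 1)) ∨
    (q.1 = p.1 ∧ q.2 = p.2 + 1 ∧ c p.1 p.2 ≠ c (p.1 - 1) p.2) ∨
    (q.1 = p.1 ∧ p.2 = q.2 + 1 ∧ c q.1 q.2 ≠ c (q.1 - 1) q.2)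
  symm := ⟨by
    rintro p q (⟨h1, h2, h3⟩ | ⟨h1, h2, h3⟩ | ⟨h1, h2, h3⟩ | ⟨h1, h2, h3⟩)
    · exact Or.inr (Or.inl ⟨h1, h2.symm, h3⟩)
    · exact Or.inl ⟨h1, h2.symm, h3⟩
    · exact Or.inr (Or.inr (Or.inr ⟨h1.symm, h2, h3⟩))
    · exact Or.inr (Or.inr (Or.inl ⟨h1.symm, h2, h3⟩))⟩
  loopless := ⟨by
    rintro p (⟨h1, h2, h3⟩ | ⟨h1, h2, h3⟩ | ⟨h1, h2, h3⟩ | ⟨h1, h2, h3⟩) <;> omega⟩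

lemma Gr_right (c : ℤ → ℤ → Bool) (i j : ℤ) :
    (Gr c).Adj (i, j) (i+1, j) ↔ c i j ≠ c i (j-1) := by
  simp only [Gr]; constructor
  · rintro (⟨h1, h2, h3⟩ | ⟨h1, h2, h3⟩ | ⟨h1, h2, h3⟩ | ⟨h1, h2, h3⟩) <;> first | exact h3 | omega
  · intro h; left; exact ⟨trivial, trivial, h⟩

lemma Gr_up (c : ℤ → ℤ → Bool) (i j : ℤ) :
    (Gr c).Adj (i, j) (i, j+1) ↔ c i j ≠ c (i-1) j := by
  simp only [Gr]; constructor
  · rintro (⟨h1, h2, h3⟩ | ⟨h1, h2, h3⟩ | ⟨h1, h2, h3⟩ | ⟨h1, h2, h3⟩) <;> first | exact h3 | omega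
  · intro h; right; right; left; exact ⟨trivial, trivial, h⟩

lemma Gr_isCycles (c : ℤ → ℤ → Bool)
    (h : ∀ i j, ¬ (c i j = c (i-1) (j-1) ∧ c (i-1) j = c i (j-1) ∧ c i j ≠ c (i-1) j)) :
    (Gr c).IsCycles := by
  rintro ⟨i, j⟩ ⟨q, hq⟩
  have hN : (Gr c).neighborSet (i,j) = {q | (q = (i+1,j) ∧ c i j ≠ c i (j-1)) ∨
     (q = (i-1,j) ∧ c (i-1) j ≠ c (i-1) (j-1)) ∨ (q = (i,j+1) ∧ c i j ≠ c (i-1) j) ∨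
     (q = (i,j-1) ∧ c i (j-1) ≠ c (i-1) (j-1))} := by
    ext ⟨a, b⟩
    simp only [SimpleGraph.mem_neighborSet, Gr, mem_ofPred_eq, Prod.mk.injEq]
    constructor
    · rintro (⟨h1, h2, h3⟩ | ⟨h1, h2, h3⟩ | ⟨h1, h2, h3⟩ | ⟨h1, h2, h3⟩)
      · subst h1 h2; simp [h3]
      · obtain rfl : a = i - 1 := by omega
        subst h2; simp [h3]
      · subst h1 h2; simp [h3]
      · obtain rfl : b = j - 1 := by omega
        subst h1; simp [h3]
    · rintro (⟨⟨h1, h2⟩, h3⟩ | ⟨⟨h1, h2⟩, h3⟩ | ⟨⟨h1, h2⟩, h3⟩ | ⟨⟨h1, h2⟩, h3⟩) <;> subst h1 h2 <;> simp [h3]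
  have hq' : q ∈ (Gr c).neighborSet (i,j) := hq
  have hne : ((Gr c).neighborSet (i,j)).Nonempty := ⟨q, hq'⟩
  rw [hN] at hne ⊢
  have hh := h i j
  clear hN hq' hq
  generalize c i j = a at *
  generalize c (i-1) j = b at *
  generalize c i (j-1) = d at *
  generalize c (i-1) (j-1) = e at *
  rw [Set.ncard_eq_two]
  revert hne
  cases a <;> cases b <;> cases d <;> cases e <;> simp at hh ⊢ 
  all_goals intro _
  all_goals refine ⟨_, _, _, _, ?_, Set.ext fun q => Iff.rfl⟩
  all_goals omega


def flipC (c : ℤ → ℤ → Bool) (e : ℤ × ℤ) : ℤ → ℤ → Bool :=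
  fun i j => if (i, j) = e then !(c i j) else c i j

/-- corners of a cell -/
def CellCorner (v e : ℤ × ℤ) : Prop :=
  (v.1 = e.1 ∨ v.1 = e.1 + 1) ∧ (v.2 = e.2 ∨ v.2 = e.2 + 1)

def DiagAdj (e e' : ℤ × ℤ) : Prop :=
  (e'.1 = e.1 + 1 ∨ e'.1 = e.1 - 1) ∧ (e'.2 = e.2 + 1 ∨ e'.2 = e.2 - 1)

lemma flip_off (c : ℤ → ℤ → Bool) (i j a b : ℤ) (h : ¬ (a = i ∧ b = j)) :
    flipC c (i, j) a b = c a b := by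
  simp only [flipC, Prod.mk.injEq]; rw [if_neg h]

lemma flip_on (c : ℤ → ℤ → Bool) (i j : ℤ) : flipC c (i, j) i j = !(c i j) := by
  simp [flipC]

lemma Gr_flip (c : ℤ → ℤ → Bool) (i j : ℤ) (a b : ℤ × ℤ) (h : (Gr c).Adj a b)
    (h1 : s(a, b) ≠ s((i, j), (i+1, j))) (h2 : s(a, b) ≠ s((i, j+1), (i+1, j+1)))
    (h3 : s(a, b) ≠ s((i, j), (i, j+1))) (h4 : s(a, b) ≠ s((i+1, j), (i+1, j+1))) :
    (Gr (flipC c (i, j))).Adj a b := by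
  obtain ⟨a1, a2⟩ := a
  obtain ⟨b1, b2⟩ := b
  simp only [ne_eq, Sym2.eq_iff, Prod.mk.injEq, not_or, not_and] at h1 h2 h3 h4
  simp only [Gr] at h ⊢
  rcases h with ⟨e1, e2, e3⟩ | ⟨e1, e2, e3⟩ | ⟨e1, e2, e3⟩ | ⟨e1, e2, e3⟩
  · left
    rw [flip_off _ _ _ _ _ (by omega), flip_off _ _ _ _ _ (by omega)]
    exact ⟨e1, e2, e3⟩
  · right; left
    rw [flip_off _ _ _ _ _ (by omega), flip_off _ _ _ _ _ (by omega)]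
    exact ⟨e1, e2, e3⟩
  · right; right; left
    rw [flip_off _ _ _ _ _ (by omega), flip_off _ _ _ _ _ (by omega)]
    exact ⟨e1, e2, e3⟩
  · right; right; right
    rw [flip_off _ _ _ _ _ (by omega), flip_off _ _ _ _ _ (by omega)]
    exact ⟨e1, e2, e3⟩

theorem comb_main (CC : Set (ℤ → ℤ → Bool)) (E : Set (ℤ × ℤ)) (c₀ : ℤ → ℤ → Bool) (hc₀ : c₀ ∈ CC)
    (e₀ : ℤ × ℤ) (he₀ : e₀ ∈ E)
    (h0 : ∀ c ∈ CC, ∀ e ∈ E, flipC c e ∈ CC)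
    (h1 : ∀ c ∈ CC, ∀ i j, (i, j) ∈ E →
      c (i-1) j = c (i+1) j ∧ c i (j-1) = c i (j+1) ∧ c i (j-1) ≠ c (i-1) j)
    (h2 : ∀ c ∈ CC, ∀ i j, ¬ (c i j = c (i-1) (j-1) ∧ c (i-1) j = c i (j-1) ∧ c i j ≠ c (i-1) j))
    (F : Set (ℤ × ℤ)) (hF : F.Finite) (h3 : ∀ c ∈ CC, (Gr c).support ⊆ F)
    (h4 : ∀ c ∈ CC, ∀ v ∈ (Gr c).support, (∃ e ∈ E, CellCorner v e) ∨
      ∃ w, (Gr c).Adj v w ∧ ∃ e ∈ E, CellCorner w e)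
    (h5 : ∀ e ∈ E, Relation.ReflTransGen (fun a b => a ∈ E ∧ b ∈ E ∧ DiagAdj a b) e₀ e) :
    ∃ c ∈ CC, (∃ w, (Gr c).Adj e₀ w) ∧ ∀ v ∈ (Gr c).support, (Gr c).Reachable e₀ v := by
  classical
  have hsupp : ∀ c ∈ CC, ∀ i j, (i, j) ∈ E → 
    ((Gr c).Adj (i,j) (i+1,j) ∧ (Gr c).Adj (i,j+1) (i+1,j+1) ∧
      (Gr (flipC c (i,j))).Adj (i,j) (i,j+1) ∧ (Gr (flipC c (i,j))).Adj (i+1,j) (i+1,j+1) ∧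
      ¬ (Gr c).Adj (i,j) (i,j+1) ∧ ¬ (Gr c).Adj (i+1,j) (i+1,j+1)) ∨
    ((Gr c).Adj (i,j) (i,j+1) ∧ (Gr c).Adj (i+1,j) (i+1,j+1) ∧
      (Gr (flipC c (i,j))).Adj (i,j) (i+1,j) ∧ (Gr (flipC c (i,j))).Adj (i,j+1) (i+1,j+1) ∧
      ¬ (Gr c).Adj (i,j) (i+1,j) ∧ ¬ (Gr c).Adj (i,j+1) (i+1,j+1)) := by
    intro c hc i j hij
    obtain ⟨a1, a2, a3⟩ := h1 c hc i j hij
    simp only [Gr_right, Gr_up, add_sub_cancel_right, flip_on]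
    rw [flip_off _ _ _ (i-1) j (by omega), flip_off _ _ _ (i+1) j (by omega), flip_off _ _ _ i (j-1) (by omega), flip_off _ _ _ i (j+1) (by omega)]
    rw [← a1, ← a2]
    generalize c i j = x at *
    generalize c (i-1) j = y at *
    generalize c i (j-1) = z at *
    revert a3
    cases x <;> cases y <;> cases z <;> simp
  have hfin : ∀ c ∈ CC, {v | (Gr c).Reachable e₀ v} ⊆ insert e₀ F := by
    intro c hc v hv
    by_cases hev : v = e₀
    · exact Or.inl hev
    · right
      apply h3 c hc
      obtain ⟨w⟩ := (hv : (Gr c).Reachable e₀ v).symm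
      cases w with
      | nil => exact absurd rfl hev
      | cons h _ => exact ⟨_, h⟩
  have hFi : (insert e₀ F).Finite := hF.insert e₀
  obtain ⟨c, hc, hmax⟩ : ∃ c ∈ CC, ∀ c' ∈ CC, 
      {v | (Gr c').Reachable e₀ v}.ncard ≤ {v | (Gr c).Reachable e₀ v}.ncard := by
    let T : Set ℕ := (fun c => {v | (Gr c).Reachable e₀ v}.ncard) '' CC
    have hT : BddAbove T := by
      refine ⟨(insert e₀ F).ncard, ?_⟩
      rintro _ ⟨c, hc, rfl⟩
      exact Set.ncard_le_ncard (hfin c hc) hFi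
    have hTn : T.Nonempty := ⟨_, c₀, hc₀, rfl⟩
    obtain ⟨c, hc, hcm⟩ := Nat.sSup_mem hTn hT
    refine ⟨c, hc, fun c' hc' => ?_⟩
    have : _ ≤ sSup T := le_csSup hT ⟨c', hc', rfl⟩
    rw [← hcm] at this
    exact this
  have hfs : (Gr c).support.Finite := hF.subset (h3 c hc)
  have hcy : (Gr c).IsCycles := Gr_isCycles c (h2 c hc)
  have hcontra : ∀ e ∈ E, ∀ s, ¬ (Gr c).Reachable e₀ s → 
      (∀ x, (Gr c).Reachable e₀ x → (Gr (flipC c e)).Reachable e₀ x) → 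
      (Gr (flipC c e)).Reachable e₀ s → False := by
    intro e he s hs ha hb
    have := hmax _ (h0 c hc e he)
    have hlt : {v | (Gr c).Reachable e₀ v}.ncard < {v | (Gr (flipC c e)).Reachable e₀ v}.ncard := by
      apply Set.ncard_lt_ncard
      · refine ⟨fun x hx => ha x hx, fun h => hs (h hb)⟩
      · exact hFi.subset (hfin _ (h0 c hc e he))
    omega
  have hcell : ∀ e ∈ E, ∀ v w, CellCorner v e → CellCorner w e → (Gr c).Reachable e₀ v → (Gr c).Reachable e₀ w := by
    rintro ⟨i, j⟩ hij ⟨v1, v2⟩ ⟨w1, w2⟩ hv hw hr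
    have hst : ((Gr c).Reachable e₀ (i,j) ↔ (Gr c).Reachable e₀ (i+1,j)) ∧ 
      ((Gr c).Reachable e₀ (i,j) ↔ (Gr c).Reachable e₀ (i,j+1)) ∧ 
      ((Gr c).Reachable e₀ (i,j) ↔ (Gr c).Reachable e₀ (i+1,j+1)) := by
      have iffadj : ∀ a b, (Gr c).Adj a b → ((Gr c).Reachable e₀ a ↔ (Gr c).Reachable e₀ b) := 
        fun a b h => ⟨fun h' => h'.trans h.reachable, fun h' => h'.trans h.symm.reachable⟩
      rcases hsupp c hc i j hij with ⟨k1, k2, k3, k4, k5, k6⟩ | ⟨k1, k2, k3, k4, k5, k6⟩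
      · have hGG : ∀ a b, (Gr c).Adj a b → s(a,b) ≠ s((i,j),(i+1,j)) → s(a,b) ≠ s((i,j+1),(i+1,j+1)) → (Gr (flipC c (i,j))).Adj a b := by
          intro a b hab m1 m2
          refine Gr_flip c i j a b hab m1 m2 ?_ ?_
          · intro h; rw [← SimpleGraph.mem_edgeSet, h, SimpleGraph.mem_edgeSet] at hab; exact k5 hab
          · intro h; rw [← SimpleGraph.mem_edgeSet, h, SimpleGraph.mem_edgeSet] at hab; exact k6 hab
        have e1 := iffadj _ _ k1
        have e2 := iffadj _ _ k2
        have e3 : (Gr c).Reachable e₀ (i,j) ↔ (Gr c).Reachable e₀ (i,j+1) := by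
          constructor
          · intro hp; by_contra hs
            obtain ⟨u1, u2⟩ := gr_merge (Gr c) _ hfs hcy k1 k2 k3 hGG hp hs
            exact hcontra _ hij _ hs u1 u2
          · intro hp; by_contra hs
            obtain ⟨u1, u2⟩ := gr_merge (Gr c) _ hfs hcy k2 k1 k3.symm (fun a b h m n => hGG a b h n m) hp hs
            exact hcontra _ hij _ hs u1 u2
        tauto
      · have hGG : ∀ a b, (Gr c).Adj a b → s(a,b) ≠ s((i,j),(i,j+1)) → s(a,b) ≠ s((i+1,j),(i+1,j+1)) → (Gr (flipC c (i,j))).Adj a b := by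
          intro a b hab m1 m2
          refine Gr_flip c i j a b hab ?_ ?_ m1 m2 
          · intro h; rw [← SimpleGraph.mem_edgeSet, h, SimpleGraph.mem_edgeSet] at hab; exact k5 hab
          · intro h; rw [← SimpleGraph.mem_edgeSet, h, SimpleGraph.mem_edgeSet] at hab; exact k6 hab
        have e1 := iffadj _ _ k1
        have e2 := iffadj _ _ k2
        have e3 : (Gr c).Reachable e₀ (i,j) ↔ (Gr c).Reachable e₀ (i+1,j) := by
          constructor
          · intro hp; by_contra hs
            obtain ⟨u1, u2⟩ := gr_merge (Gr c) _ hfs hcy k1 k2 k3 hGG hp hs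
            exact hcontra _ hij _ hs u1 u2
          · intro hp; by_contra hs
            obtain ⟨u1, u2⟩ := gr_merge (Gr c) _ hfs hcy k2 k1 k3.symm (fun a b h m n => hGG a b h n m) hp hs
            exact hcontra _ hij _ hs u1 u2
        tauto
    simp only [CellCorner] at hv hw
    obtain ⟨rfl | rfl, rfl | rfl⟩ := hv <;> obtain ⟨rfl | rfl, rfl | rfl⟩ := hw <;> tauto
  have hallE : ∀ e ∈ E, ∀ v, CellCorner v e → (Gr c).Reachable e₀ v := by
    intro e he
    have := h5 e he
    induction this with
    | refl => 
      intro v hv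
      exact hcell e₀ he₀ e₀ v (by simp [CellCorner]) hv (SimpleGraph.Reachable.refl _)
    | @tail a b hab hb ih =>
      intro v hv
      obtain ⟨w, hw1, hw2⟩ : ∃ w, CellCorner w a ∧ CellCorner w b := by
        obtain ⟨k1, k2⟩ := hb.2.2
        refine ⟨(max a.1 b.1, max a.2 b.2), ?_, ?_⟩ <;> simp only [CellCorner] <;> omega
      exact hcell b hb.2.1 w v hw2 hv (ih hb.1 w hw1)
  refine ⟨c, hc, ?_, ?_⟩
  · obtain ⟨i, j⟩ := e₀
    rcases hsupp c hc i j he₀ with h | h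
    · exact ⟨_, h.1⟩
    · exact ⟨_, h.1⟩
  · intro v hv
    rcases h4 c hc v hv with ⟨e, he, hve⟩ | ⟨w, hvw, e, he, hwe⟩
    · exact hallE e he v hve
    · exact (hallE e he w hwe).trans hvw.symm.reachable


def dlt (i : ℤ) : Bool := decide (i % 2 = 0)

def MonoC (f : ℤ → ℤ → Bool) (E : Set (ℤ × ℤ)) (i j : ℤ) : Prop :=
  ((i-1, j) ∉ E ∧ f (i-1) j = !(dlt i)) ∧ ((i+1, j) ∉ E ∧ f (i+1) j = !(dlt i)) ∧
  ((i, j-1) ∉ E ∧ f i (j-1) = !(dlt i)) ∧ ((i, j+1) ∉ E ∧ f i (j+1) = !(dlt i))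

open Classical in
noncomputable def baseC (f : ℤ → ℤ → Bool) (E : Set (ℤ × ℤ)) (i j : ℤ) : Bool :=
  if (i + j) % 2 = 1 then f i j else if MonoC f E i j then !(dlt i) else dlt i

lemma baseC_odd (f : ℤ → ℤ → Bool) (E : Set (ℤ × ℤ)) (i j : ℤ) (h : (i + j) % 2 = 1) :
    baseC f E i j = f i j := by simp [baseC, h]

lemma baseC_mono (f : ℤ → ℤ → Bool) (E : Set (ℤ × ℤ)) (i j : ℤ) (h : (i + j) % 2 = 0)
    (hm : MonoC f E i j) : baseC f E i j = !(dlt i) := by simp [baseC, h, hm]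

lemma baseC_nmono (f : ℤ → ℤ → Bool) (E : Set (ℤ × ℤ)) (i j : ℤ) (h : (i + j) % 2 = 0)
    (hm : ¬ MonoC f E i j) : baseC f E i j = dlt i := by simp [baseC, h, hm]

lemma dlt_sub (i : ℤ) : dlt (i - 1) = !(dlt i) := by
  by_cases h : i % 2 = 0
  · simp [dlt, h]; omega
  · simp [dlt, h]; omega

lemma dlt_add (i : ℤ) : dlt (i + 1) = !(dlt i) := by
  by_cases h : i % 2 = 0
  · simp [dlt, h]; omega
  · simp [dlt, h]; omega

theorem comb2 (f : ℤ → ℤ → Bool) (E : Set (ℤ × ℤ)) (hE : ∀ i j, (i, j) ∈ E → (i + j) % 2 = 1)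
    (e₀ : ℤ × ℤ) (he₀ : e₀ ∈ E)
    (hcons : ∀ a b a' b', (a + b) % 2 = 1 → DiagAdj (a, b) (a', b') → (a, b) ∉ E → (a', b') ∉ E →
      f a b = f a' b')
    (N : ℤ) (hN : ∀ i j, (i + j) % 2 = 1 → (N < |i| ∨ N < |j|) → (i, j) ∉ E ∧ f i j = false)
    (h5 : ∀ e ∈ E, Relation.ReflTransGen (fun a b => a ∈ E ∧ b ∈ E ∧ DiagAdj a b) e₀ e) :
    ∃ c : ℤ → ℤ → Bool, (∀ i j, (i, j) ∉ E → c i j = baseC f E i j) ∧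
      (Gr c).support.Finite ∧ (Gr c).IsCycles ∧
      (∃ w, (Gr c).Adj e₀ w) ∧ ∀ v ∈ (Gr c).support, (Gr c).Reachable e₀ v := by
  let CC : Set (ℤ → ℤ → Bool) := {c | ∀ i j, (i, j) ∉ E → c i j = baseC f E i j}
  have hev : ∀ c ∈ CC, ∀ i j, (i + j) % 2 = 0 → (c i j = dlt i ∧ ¬ MonoC f E i j) ∨
      (c i j = !(dlt i) ∧ MonoC f E i j) := by
    intro c hc i j hij
    have h1 : (i, j) ∉ E := fun h => by have := hE i j h; omega
    rw [hc i j h1]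
    by_cases hm : MonoC f E i j
    · right; exact ⟨baseC_mono f E i j hij hm, hm⟩
    · left; exact ⟨baseC_nmono f E i j hij hm, hm⟩
  have hod : ∀ c ∈ CC, ∀ i j, (i + j) % 2 = 1 → (i, j) ∉ E → c i j = f i j := by
    intro c hc i j hij h
    rw [hc i j h, baseC_odd f E i j hij]
  have h2 : ∀ c ∈ CC, ∀ i j, ¬ (c i j = c (i-1) (j-1) ∧ c (i-1) j = c i (j-1) ∧ c i j ≠ c (i-1) j) := by
    rintro c hc i j ⟨k1, k2, k3⟩
    rcases Int.emod_two_eq_zero_or_one (i + j) with hij | hij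
    · have a1 := hev c hc i j hij
      have a2 := hev c hc (i-1) (j-1) (by omega)
      have b1 := hod c hc (i-1) j (by omega)
      have b2 := hod c hc i (j-1) (by omega)
      simp only [MonoC, dlt_sub, sub_add_cancel] at a1 a2
      grind
    · have a1 := hev c hc (i-1) j (by omega)
      have a2 := hev c hc i (j-1) (by omega)
      have b1 := hod c hc i j (by omega)
      have b2 := hod c hc (i-1) (j-1) (by omega)
      simp only [MonoC, dlt_sub, sub_add_cancel] at a1 a2
      grind
  have h3 : ∀ c ∈ CC, ∀ i j, (N + 2 < |i| ∨ N + 2 < |j|) → c i j = false := by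
    intro c hc i j hij
    rcases Int.emod_two_eq_zero_or_one (i + j) with h | h
    · have a := hev c hc i j h
      have n1 := hN (i-1) j (by omega) (by simp only [lt_abs] at hij ⊢; omega)
      have n2 := hN (i+1) j (by omega) (by simp only [lt_abs] at hij ⊢; omega)
      have n3 := hN i (j-1) (by omega) (by simp only [lt_abs] at hij ⊢; omega)
      have n4 := hN i (j+1) (by omega) (by simp only [lt_abs] at hij ⊢; omega)
      simp only [MonoC, n1, n2, n3, n4] at a
      revert a
      generalize dlt i = d
      cases d <;> simp
    · have n1 := hN i j h (by simp only [lt_abs] at hij ⊢; omega)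
      rw [hod c hc i j h n1.1, n1.2]
  have hadj : ∀ c i j, ((i, j) : ℤ × ℤ) ∈ (Gr c).support → ¬ (c i j = c (i-1) j ∧ c i j = c i (j-1) ∧ c i j = c (i-1) (j-1)) := by
    rintro c i j ⟨⟨a, b⟩, h⟩ ⟨q1, q2, q3⟩
    simp only [Gr] at h
    rcases h with ⟨h1, h2, h3⟩ | ⟨h1, h2, h3⟩ | ⟨h1, h2, h3⟩ | ⟨h1, h2, h3⟩ <;> dsimp only at h1 h2 h3
    · exact h3 q2
    · obtain rfl : a = i - 1 := by omega
      subst h2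
      exact h3 (q1.symm.trans q3)
    · exact h3 q1
    · obtain rfl : b = j - 1 := by omega
      subst h1
      exact h3 (q2.symm.trans q3)
  have h4 : ∀ c ∈ CC, ∀ v ∈ (Gr c).support, (∃ e ∈ E, CellCorner v e) ∨
      ∃ w, (Gr c).Adj v w ∧ ∃ e ∈ E, CellCorner w e := by
    rintro c hc ⟨i, j⟩ hv
    have hne := hadj c i j hv
    by_cases hcor : ∃ e ∈ E, CellCorner (i, j) e
    · exact Or.inl hcor
    right
    have z1 : (i, j) ∉ E := fun h => hcor ⟨_, h, by simp [CellCorner]⟩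
    have z2 : (i-1, j) ∉ E := fun h => hcor ⟨_, h, by simp [CellCorner]⟩
    have z3 : (i, j-1) ∉ E := fun h => hcor ⟨_, h, by simp [CellCorner]⟩
    have z4 : (i-1, j-1) ∉ E := fun h => hcor ⟨_, h, by simp [CellCorner]⟩
    have ad1 : c i j ≠ c i (j-1) → (Gr c).Adj (i, j) (i+1, j) := (Gr_right c i j).2
    have ad2 : c i j ≠ c (i-1) j → (Gr c).Adj (i, j) (i, j+1) := (Gr_up c i j).2
    have ad3 : c (i-1) j ≠ c (i-1) (j-1) → (Gr c).Adj (i, j) (i-1, j) := by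
      have := (Gr_right c (i-1) j).2
      rw [sub_add_cancel] at this
      exact fun h => (this h).symm
    have ad4 : c i (j-1) ≠ c (i-1) (j-1) → (Gr c).Adj (i, j) (i, j-1) := by
      have := (Gr_up c i (j-1)).2
      rw [sub_add_cancel] at this
      exact fun h => (this h).symm
    by_contra hgoal
    have goal : ∀ w e : ℤ × ℤ, CellCorner w e → (Gr c).Adj (i, j) w → e ∈ E → False :=
      fun w e r p q => hgoal ⟨w, p, e, q, r⟩
    rcases Int.emod_two_eq_zero_or_one (i + j) with hij | hij
    · have a1 := hev c hc i j hij
      have a2 := hev c hc (i-1) (j-1) (by omega)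
      have b1 := hod c hc (i-1) j (by omega) z2
      have b2 := hod c hc i (j-1) (by omega) z3
      have c0 := hcons (i-1) j i (j-1) (by omega) (by simp [DiagAdj]) z2 z3
      have c1 := hcons (i-1) j i (j+1) (by omega) (by simp [DiagAdj]) z2
      have c2 := hcons i (j-1) (i+1) j (by omega) (by simp [DiagAdj]) z3
      have c3 := hcons (i-1) j (i-1-1) (j-1) (by omega) (by simp [DiagAdj]) z2
      have c4 := hcons i (j-1) (i-1) (j-1-1) (by omega) (by simp [DiagAdj]) z3
      have d1 := goal (i, j+1) (i, j+1) (by simp [CellCorner])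
      have d2 := goal (i+1, j) (i+1, j) (by simp [CellCorner])
      have d3 := goal (i-1, j) (i-1-1, j-1) (by simp [CellCorner])
      have d4 := goal (i, j-1) (i-1, j-1-1) (by simp [CellCorner])
      simp only [MonoC, dlt_sub, sub_add_cancel] at a1 a2
      clear hev hod h2 h3 hadj hcons hN h5 goal hE hcor hgoal hv hc
      clear_value CC
      clear CC
      clear he₀
      clear e₀
      generalize dlt i = t at *
      have m0 := Classical.em ((i, j+1) ∈ E)
      have m1 := Classical.em ((i+1, j) ∈ E)
      have m2 := Classical.em ((i-1-1, j-1) ∈ E)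
      have m3 := Classical.em ((i-1, j-1-1) ∈ E)
      have mf := Bool.eq_false_or_eq_true (f (i-1) j)
      clear hij
      cases t <;> simp only [Bool.not_true, Bool.not_false] at a1 a2 <;> rcases mf with mf | mf <;>
        rcases m0 with m0 | m0 <;> rcases m1 with m1 | m1 <;> grind
    · have a1 := hev c hc (i-1) j (by omega)
      have a2 := hev c hc i (j-1) (by omega)
      have b1 := hod c hc i j (by omega) z1
      have b2 := hod c hc (i-1) (j-1) (by omega) z4
      have c0 := hcons i j (i-1) (j-1) (by omega) (by simp [DiagAdj]) z1 z4
      have c1 := hcons i j (i-1) (j+1) (by omega) (by simp [DiagAdj]) z1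
      have c2 := hcons i j (i+1) (j-1) (by omega) (by simp [DiagAdj]) z1
      have c3 := hcons (i-1) (j-1) (i-1-1) j (by omega) (by simp [DiagAdj]) z4
      have c4 := hcons (i-1) (j-1) i (j-1-1) (by omega) (by simp [DiagAdj]) z4
      have d1 := goal (i, j+1) (i-1, j+1) (by simp [CellCorner])
      have d2 := goal (i+1, j) (i+1, j-1) (by simp [CellCorner])
      have d3 := goal (i-1, j) (i-1-1, j) (by simp [CellCorner])
      have d4 := goal (i, j-1) (i, j-1-1) (by simp [CellCorner])
      simp only [MonoC, dlt_sub, sub_add_cancel] at a1 a2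
      clear hev hod h2 h3 hadj hcons hN h5 goal hE hcor hgoal hv hc
      clear_value CC
      clear CC
      clear he₀
      clear e₀
      generalize dlt i = t at *
      have m0 := Classical.em ((i-1, j+1) ∈ E)
      have m1 := Classical.em ((i+1, j-1) ∈ E)
      have m2 := Classical.em ((i-1-1, j) ∈ E)
      have m3 := Classical.em ((i, j-1-1) ∈ E)
      have mf := Bool.eq_false_or_eq_true (f i j)
      clear hij
      cases t <;> simp only [Bool.not_true, Bool.not_false] at a1 a2 <;> rcases mf with mf | mf <;>
        rcases m0 with m0 | m0 <;> rcases m1 with m1 | m1 <;> grind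
  have hFs : ∀ c ∈ CC, (Gr c).support ⊆ Set.Icc (-(N+4)) (N+4) ×ˢ Set.Icc (-(N+4)) (N+4) := by
    rintro c hc ⟨i, j⟩ hv
    have hne := hadj c i j hv
    by_contra hb
    simp only [mem_prod, mem_Icc] at hb
    simp only [lt_abs] at h3
    rw [h3 c hc i j (by omega), h3 c hc (i-1) j (by omega), h3 c hc i (j-1) (by omega), h3 c hc (i-1) (j-1) (by omega)] at hne
    simp at hne
  have hFf : (Set.Icc (-(N+4)) (N+4) ×ˢ Set.Icc (-(N+4)) (N+4)).Finite :=
    (Set.finite_Icc _ _).prod (Set.finite_Icc _ _)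
  have h0 : ∀ c ∈ CC, ∀ e ∈ E, flipC c e ∈ CC := by
    intro c hc e he i j hij
    have : (i, j) ≠ e := fun h => hij (h ▸ he)
    simp only [flipC, if_neg this]
    exact hc i j hij
  have h1 : ∀ c ∈ CC, ∀ i j, (i, j) ∈ E →
      c (i-1) j = c (i+1) j ∧ c i (j-1) = c i (j+1) ∧ c i (j-1) ≠ c (i-1) j := by
    intro c hc i j hij
    have ho := hE i j hij
    have a1 := hev c hc (i-1) j (by omega)
    have a2 := hev c hc (i+1) j (by omega)
    have a3 := hev c hc i (j-1) (by omega)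
    have a4 := hev c hc i (j+1) (by omega)
    simp only [MonoC, sub_add_cancel, add_sub_cancel_right, hij, dlt_sub, dlt_add] at a1 a2 a3 a4
    simp at a1 a2 a3 a4
    rw [a1, a2, a3, a4]
    simp
  obtain ⟨c, hc, hw, hr⟩ := comb_main CC E (baseC f E) (fun _ _ _ => rfl) e₀ he₀ h0 h1 h2 _ hFf hFs h4 h5
  exact ⟨c, hc, hFf.subset (hFs c hc), Gr_isCycles c (h2 c hc), hw, hr⟩

def UnitStep (p q : ℤ × ℤ) : Prop :=
  (q.1 = p.1 + 1 ∧ q.2 = p.2) ∨ (q.1 = p.1 - 1 ∧ q.2 = p.2) ∨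
  (q.1 = p.1 ∧ q.2 = p.2 + 1) ∨ (q.1 = p.1 ∧ q.2 = p.2 - 1)

lemma int_step_aux (x x' : ℤ) (a b : ℝ) (ha : 0 ≤ a) (ha1 : a < 1) (hb : 0 ≤ b) (hb1 : b < 1)
    (h : (x:ℝ) + a = x' + b) : x = x' ∧ a = b := by
  have h1 : x < x' + 1 := by
    have : (x:ℝ) < x' + 1 := by linarith
    exact_mod_cast this
  have h2 : x' < x + 1 := by
    have : (x':ℝ) < x + 1 := by linarith
    exact_mod_cast this
  have h3 : x = x' := by omega
  refine ⟨h3, ?_⟩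
  rw [h3] at h; linarith

lemma int_step_aux2 (x x' : ℤ) (a b : ℝ) (ha : 0 ≤ a) (ha1 : a < 1) (hb : 0 ≤ b) (hb1 : b < 1)
    (h : (x:ℝ) + a = x' - b) : (x = x' ∧ a = b) ∨ x' = x + 1 := by
  have h1 : x ≤ x' := by
    have : (x:ℝ) ≤ x' := by linarith
    exact_mod_cast this
  have h2 : x' < x + 2 := by
    have : (x':ℝ) < x + 2 := by linarith
    exact_mod_cast this
  rcases (by omega : x = x' ∨ x' = x + 1) with h3 | h3
  · left
    refine ⟨h3, ?_⟩
    rw [h3] at h; linarith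
  · exact Or.inr h3

lemma int_one (x x' d d' : ℤ) (a b : ℝ)
    (ha : 0 ≤ a) (ha1 : a < 1) (hb : 0 ≤ b) (hb1 : b < 1)
    (hd : d = 0 ∨ d = 1 ∨ d = -1) (hd' : d' = 0 ∨ d' = 1 ∨ d' = -1)
    (h : (x : ℝ) + a * d = x' + b * d') :
    (d = 0 → d' = 0 → x = x') ∧ (d = 0 → d' ≠ 0 → x = x' ∧ b = 0) ∧
    (d ≠ 0 → d' = 0 → x = x' ∧ a = 0) ∧ (d ≠ 0 → d' = d → x = x' ∧ a = b) ∧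
    (d ≠ 0 → d' = -d → (x = x' ∧ a = b) ∨ x' = x + d) := by
  rcases hd with rfl | rfl | rfl <;> rcases hd' with rfl | rfl | rfl <;> push_cast at h <;> norm_num
  · have : (x:ℝ) = x' := by linarith
    exact_mod_cast this
  · obtain ⟨e1, e2⟩ := int_step_aux x x' 0 b le_rfl one_pos hb hb1 (by linarith)
    exact ⟨e1, e2.symm⟩
  · obtain ⟨e1, e2⟩ := int_step_aux x' x 0 b le_rfl one_pos hb hb1 (by linarith) |>.symm.symm |> fun _ => int_step_aux x' x b 0 hb hb1 le_rfl one_pos (by linarith)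
    exact ⟨e1.symm, e2⟩
  · obtain ⟨e1, e2⟩ := int_step_aux x x' a 0 ha ha1 le_rfl one_pos (by linarith)
    exact ⟨e1, e2⟩
  · obtain ⟨e1, e2⟩ := int_step_aux x x' a b ha ha1 hb hb1 (by linarith)
    exact ⟨e1, e2⟩
  · exact int_step_aux2 x x' a b ha ha1 hb hb1 (by linarith)
  · obtain ⟨e1, e2⟩ := int_step_aux x' x a 0 ha ha1 le_rfl one_pos (by linarith)
    exact ⟨e1.symm, e2⟩
  · rcases int_step_aux2 x' x b a hb hb1 ha ha1 (by linarith) with ⟨e1, e2⟩ | e1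
    · exact Or.inl ⟨e1.symm, e2.symm⟩
    · right; omega
  · obtain ⟨e1, e2⟩ := int_step_aux x' x a b ha ha1 hb hb1 (by linarith)
    exact ⟨e1.symm, e2⟩

lemma edge_meet (p q p' q' : ℤ × ℤ) (hpq : UnitStep p q) (hpq' : UnitStep p' q') (a b : ℝ)
    (ha : 0 ≤ a) (ha1 : a < 1) (hb : 0 ≤ b) (hb1 : b < 1)
    (h1 : (p.1 : ℝ) + a * (q.1 - p.1) = p'.1 + b * (q'.1 - p'.1))
    (h2 : (p.2 : ℝ) + a * (q.2 - p.2) = p'.2 + b * (q'.2 - p'.2)) :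
    (p = p' ∧ a = b) ∨ (q = p' ∧ q' = p) := by
  simp only [UnitStep] at hpq hpq'
  have A := int_one p.1 p'.1 (q.1 - p.1) (q'.1 - p'.1) a b ha ha1 hb hb1 (by omega) (by omega)
    (by push_cast; exact h1)
  have B := int_one p.2 p'.2 (q.2 - p.2) (q'.2 - p'.2) a b ha ha1 hb hb1 (by omega) (by omega)
    (by push_cast; exact h2)
  simp only [Prod.ext_iff]
  clear h1 h2
  rcases hpq with ⟨h1, h2⟩ | ⟨h1, h2⟩ | ⟨h1, h2⟩ | ⟨h1, h2⟩ <;>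
  rcases hpq' with ⟨h3, h4⟩ | ⟨h3, h4⟩ | ⟨h3, h4⟩ | ⟨h3, h4⟩ <;>
  rw [h1, h3] at A <;> rw [h2, h4] at B <;> simp at A B <;> grind

def ptC (ε : ℝ) (p : ℤ × ℤ) : ℂ := ⟨ε * p.1, ε * p.2⟩

noncomputable def polyS (z : ℕ → ℂ) (m : ℕ) (t : ℝ) : ℂ :=
  z 0 + ∑ i ∈ Finset.range m, ((max 0 (min 1 (t - i)) : ℝ) : ℂ) * (z (i+1) - z i)

lemma polyS_ge (z : ℕ → ℂ) (m : ℕ) (t : ℝ) (h : (m:ℝ) ≤ t) : polyS z m t = z m := by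
  induction m with
  | zero => simp [polyS]
  | succ k ih =>
    push_cast at h
    have := ih (by linarith)
    simp only [polyS] at this ⊢
    rw [Finset.sum_range_succ, ← add_assoc, this, min_eq_left (by linarith), max_eq_right (by linarith)]
    push_cast; ring

lemma polyS_le (z : ℕ → ℂ) (m k : ℕ) (t : ℝ) (h : t ≤ m) : polyS z (m + k) t = polyS z m t := by
  induction k with
  | zero => rfl
  | succ k ih =>
    rw [← ih]
    simp only [polyS]
    rw [← add_assoc, Finset.sum_range_succ]
    have : (0:ℝ) ≤ k := by positivity
    rw [max_eq_left]
    · simp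
    · apply min_le_of_right_le; push_cast; linarith

lemma polyS_eq (z : ℕ → ℂ) (n k : ℕ) (hk : k < n) (t : ℝ) (h : (k:ℝ) ≤ t) (h' : t ≤ k + 1) :
    polyS z n t = z k + ((t - k : ℝ) : ℂ) * (z (k+1) - z k) := by
  obtain ⟨m, rfl⟩ : ∃ m, n = (k + 1) + m := ⟨n - (k+1), by omega⟩
  rw [polyS_le z (k+1) m t (by push_cast; exact h')]
  have := polyS_ge z k t h
  simp only [polyS] at this ⊢
  rw [Finset.sum_range_succ, ← add_assoc, this, min_eq_right (by linarith), max_eq_right (by linarith)]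

lemma polyS_cont (z : ℕ → ℂ) (n : ℕ) : Continuous (polyS z n) := by
  unfold polyS
  fun_prop

theorem poly_loop (ε : ℝ) (hε : 0 < ε) (n : ℕ) (p : ℕ → ℤ × ℤ) (hn : 3 ≤ n) (hp : p n = p 0)
    (hinj : ∀ i < n, ∀ j < n, p i = p j → i = j) (hstep : ∀ i < n, UnitStep (p i) (p (i+1))) :
    ∃ γ : ℝ → ℂ, IsJordanLoop γ ∧
      γ '' Set.Icc 0 1 = ⋃ i ∈ Set.Iio n, segment ℝ (ptC ε (p i)) (ptC ε (p (i+1))) := by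
  have hn0 : (0:ℝ) < n := by exact_mod_cast (by omega : 0 < n)
  let z : ℕ → ℂ := fun i => ptC ε (p i)
  refine ⟨fun t => polyS z n (n * t), ⟨?_, ?_, ?_⟩, ?_⟩
  · exact ((polyS_cont z n).comp (by fun_prop)).continuousOn
  · simp only [mul_zero, mul_one]
    rw [polyS_ge z n n le_rfl, polyS_eq z n 0 (by omega) 0 (by simp) (by simp)]
    simp [z, hp]
  · intro s hs t ht hst
    simp only at hst
    have key : ∀ s ∈ Set.Ico (0:ℝ) 1, ∃ k : ℕ, k < n ∧ (k:ℝ) ≤ n * s ∧ n * s < k + 1 := by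
      intro s hs
      have h0 : 0 ≤ n * s := mul_nonneg hn0.le hs.1
      refine ⟨⌊n * s⌋₊, ?_, Nat.floor_le h0, Nat.lt_floor_add_one _⟩
      rw [Nat.floor_lt h0]
      nlinarith [hs.2]
    obtain ⟨k, hk, hk1, hk2⟩ := key s hs
    obtain ⟨l, hl, hl1, hl2⟩ := key t ht
    rw [polyS_eq z n k hk _ hk1 hk2.le, polyS_eq z n l hl _ hl1 hl2.le] at hst
    have e1 := congrArg Complex.re hst
    have e2 := congrArg Complex.im hst
    simp only [z, ptC, Complex.add_re, Complex.add_im, Complex.re_ofReal_mul, Complex.im_ofReal_mul,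
      Complex.sub_re, Complex.sub_im] at e1 e2
    have := edge_meet (p k) (p (k+1)) (p l) (p (l+1)) (hstep k hk) (hstep l hl) (n * s - k) (n * t - l)
      (by linarith) (by linarith) (by linarith) (by linarith)
      (by apply mul_left_cancel₀ hε.ne'; linarith) (by apply mul_left_cancel₀ hε.ne'; linarith)
    rcases this with ⟨h1, h2⟩ | ⟨h1, h2⟩
    · have := hinj k hk l hl h1
      subst this
      have : (n:ℝ) * s = n * t := by linarith
      exact mul_left_cancel₀ hn0.ne' this
    · exfalso
      have q1 : ∀ a b, a < n → b < n → p (a+1) = p b → b = a + 1 ∨ (a + 1 = n ∧ b = 0) := by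
        intro a b ha hb hab
        rcases (by omega : a + 1 < n ∨ a + 1 = n) with h | h
        · exact Or.inl (hinj _ h _ hb hab).symm
        · right
          refine ⟨h, ?_⟩
          rw [h, hp] at hab
          exact (hinj 0 (by omega) b hb hab).symm
      have := q1 k l hk hl h1
      have := q1 l k hl hk h2
      omega
  · ext w
    simp only [mem_image, mem_iUnion, mem_Iio, exists_prop]
    constructor
    · rintro ⟨t, ht, rfl⟩
      obtain ⟨k, hk, hk1, hk2⟩ : ∃ k : ℕ, k < n ∧ (k:ℝ) ≤ n * t ∧ n * t ≤ k + 1 := by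
        have h0 : 0 ≤ n * t := mul_nonneg hn0.le ht.1
        rcases lt_or_eq_of_le ht.2 with h | h
        · refine ⟨⌊n * t⌋₊, ?_, Nat.floor_le h0, (Nat.lt_floor_add_one _).le⟩
          rw [Nat.floor_lt h0]
          nlinarith
        · refine ⟨n - 1, by omega, ?_, ?_⟩ <;> rw [h, Nat.cast_sub (by omega)] <;> simp
      refine ⟨k, hk, ?_⟩
      rw [polyS_eq z n k hk _ hk1 hk2, segment_eq_image']
      exact ⟨n * t - k, ⟨by linarith, by linarith⟩, by simp [z]⟩
    · rintro ⟨k, hk, hw⟩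
      rw [segment_eq_image'] at hw
      obtain ⟨θ, hθ, rfl⟩ := hw
      have hk' : (k:ℝ) + 1 ≤ n := by exact_mod_cast hk
      refine ⟨(k + θ) / n, ⟨by have := hθ.1; positivity, ?_⟩, ?_⟩
      · rw [div_le_one hn0]; linarith [hθ.2]
      · rw [mul_div_cancel₀ _ hn0.ne', polyS_eq z n k hk _ (by linarith [hθ.1]) (by linarith [hθ.2])]
        simp [z]


lemma base_unif (f : ℤ → ℤ → Bool) (E : Set (ℤ × ℤ)) (i j : ℤ) (b : Bool)
    (h : ∀ a b', (a + b') % 2 = 1 → |a - i| ≤ 1 → |b' - j| ≤ 1 → (a, b') ∉ E ∧ f a b' = b) :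
    baseC f E i j = b := by
  rcases Int.emod_two_eq_zero_or_one (i + j) with h0 | h1
  · have n1 := h (i-1) j (by omega) (by simp) (by simp)
    have n2 := h (i+1) j (by omega) (by simp) (by simp)
    have n3 := h i (j-1) (by omega) (by simp) (by simp)
    have n4 := h i (j+1) (by omega) (by simp) (by simp)
    by_cases hm : MonoC f E i j
    · rw [baseC_mono f E i j h0 hm]
      rw [← hm.1.2]; exact n1.2
    · rw [baseC_nmono f E i j h0 hm]
      by_contra hne
      apply hm
      have : b = !(dlt i) := by
        cases b <;> cases hdl : dlt i <;> simp_all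
      subst this
      exact ⟨n1, n2, n3, n4⟩
  · rw [baseC_odd f E i j h1]
    exact (h i j h1 (by simp) (by simp)).2

lemma star_conn (k e e' : ℤ × ℤ) (he : (e.1 + e.2) % 2 = 1) (he' : (e'.1 + e'.2) % 2 = 1)
    (h1 : |e.1 - k.1| ≤ 1) (h2 : |e.2 - k.2| ≤ 1) (h1' : |e'.1 - k.1| ≤ 1) (h2' : |e'.2 - k.2| ≤ 1) :
    ∃ m : ℤ × ℤ, (m.1 + m.2) % 2 = 1 ∧ |m.1 - k.1| ≤ 1 ∧ |m.2 - k.2| ≤ 1 ∧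
      (e = m ∨ DiagAdj e m) ∧ (m = e' ∨ DiagAdj m e') := by
  obtain ⟨e1, e2⟩ := e
  obtain ⟨e1', e2'⟩ := e'
  obtain ⟨k1, k2⟩ := k
  simp only [abs_le, DiagAdj] at *
  rcases Int.emod_two_eq_zero_or_one (k1 + k2) with h0 | h0
  · by_cases hv : e1 = k1
    · by_cases hv' : e1' = k1
      · exact ⟨(k1 + 1, k2), by simp only; omega, by simp, by simp, by simp only; omega, by simp only; omega⟩
      · exact ⟨(e1', e2'), by simp only; omega, by simp only; omega, by simp only; omega, by simp only; omega, by simp⟩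
    · by_cases hv' : e1' = k1
      · exact ⟨(e1', e2'), by simp only; omega, by simp only; omega, by simp only; omega, by simp only; omega, by simp⟩
      · exact ⟨(k1, k2 + 1), by simp only; omega, by simp, by simp, by simp only; omega, by simp only; omega⟩
  · exact ⟨(k1, k2), by simp only; omega, by simp, by simp, by simp only [Prod.mk.injEq]; omega, by simp only [Prod.mk.injEq]; omega⟩

lemma star_common (k k' : ℤ × ℤ) (h1 : |k.1 - k'.1| ≤ 1) (h2 : |k.2 - k'.2| ≤ 1) :
    ∃ m : ℤ × ℤ, (m.1 + m.2) % 2 = 1 ∧ |m.1 - k.1| ≤ 1 ∧ |m.2 - k.2| ≤ 1 ∧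
      |m.1 - k'.1| ≤ 1 ∧ |m.2 - k'.2| ≤ 1 := by
  obtain ⟨k1, k2⟩ := k
  obtain ⟨l1, l2⟩ := k'
  simp only [abs_le] at *
  by_cases h0 : (k1 + k2) % 2 = 1
  · exact ⟨(k1, k2), by simp only; omega, by simp, by simp, by simp only; omega, by simp only; omega⟩
  by_cases h0' : (l1 + l2) % 2 = 1
  · exact ⟨(l1, l2), by simp only; omega, by simp only; omega, by simp only; omega, by simp, by simp⟩
  by_cases he : k1 = l1
  · exact ⟨(k1+1, k2), by simp only; omega, by simp only; omega, by simp only; omega, by simp only; omega, by simp only; omega⟩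
  · exact ⟨(k1, l2), by simp only; omega, by simp only; omega, by simp only; omega, by simp only; omega, by simp only; omega⟩

noncomputable def fcell (ε : ℝ) (z : ℂ) : ℤ × ℤ := (⌊z.re / ε⌋, ⌊z.im / ε⌋)

def CellS (ε : ℝ) (k : ℤ × ℤ) : Set ℂ :=
  {z | ε * k.1 ≤ z.re ∧ z.re ≤ ε * (k.1 + 1) ∧ ε * k.2 ≤ z.im ∧ z.im ≤ ε * (k.2 + 1)}

lemma mem_cellS {ε : ℝ} {k : ℤ × ℤ} {z : ℂ} : z ∈ CellS ε k ↔
  (ε * k.1 ≤ z.re ∧ z.re ≤ ε * (k.1 + 1) ∧ ε * k.2 ≤ z.im ∧ z.im ≤ ε * (k.2 + 1)) := Iff.rfl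

lemma fcell_mem {ε : ℝ} (hε : 0 < ε) (z : ℂ) : z ∈ CellS ε (fcell ε z) := by
  have a1 := Int.floor_le (z.re / ε)
  have a2 := (Int.lt_floor_add_one (z.re / ε)).le
  have b1 := Int.floor_le (z.im / ε)
  have b2 := (Int.lt_floor_add_one (z.im / ε)).le
  rw [le_div_iff₀ hε] at a1 b1
  rw [div_le_iff₀ hε] at a2 b2
  refine mem_cellS.2 ⟨?_, ?_, ?_, ?_⟩ <;> simp only [fcell] <;> linarith

lemma fcell_ptC {ε : ℝ} (hε : 0 < ε) (k : ℤ × ℤ) : fcell ε (ptC ε k) = k := by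
  simp [fcell, ptC, mul_div_cancel_left₀ _ hε.ne']

lemma ptC_mem {ε : ℝ} (hε : 0 < ε) (k : ℤ × ℤ) : ptC ε k ∈ CellS ε k := by
  refine mem_cellS.2 ⟨?_, ?_, ?_, ?_⟩ <;> simp only [ptC] <;> nlinarith

lemma fcell_near {ε : ℝ} (hε : 0 < ε) (z w : ℂ) (h : dist z w < ε) :
    |(fcell ε z).1 - (fcell ε w).1| ≤ 1 ∧ |(fcell ε z).2 - (fcell ε w).2| ≤ 1 := by
  rw [Complex.dist_eq] at h
  have hr := (Complex.abs_re_le_norm (z - w)).trans_lt h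
  have hi := (Complex.abs_im_le_norm (z - w)).trans_lt h
  simp only [Complex.sub_re, Complex.sub_im] at hr hi
  have key : ∀ x y : ℝ, |x - y| < ε → |⌊x / ε⌋ - ⌊y / ε⌋| ≤ 1 := by
    intro x y hxy
    have h1 : |x / ε - y / ε| < 1 := by
      rw [← sub_div, abs_div, abs_of_pos hε, div_lt_one hε]; exact hxy
    rw [abs_lt] at h1
    have a1 := Int.floor_le (x / ε)
    have a2 := Int.lt_floor_add_one (x / ε)
    have b1 := Int.floor_le (y / ε)
    have b2 := Int.lt_floor_add_one (y / ε)
    rw [abs_le]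
    constructor
    · have : (⌊y / ε⌋ : ℝ) < ⌊x / ε⌋ + 2 := by linarith
      have : ⌊y / ε⌋ < ⌊x / ε⌋ + 2 := by exact_mod_cast this
      omega
    · have : (⌊x / ε⌋ : ℝ) < ⌊y / ε⌋ + 2 := by linarith
      have : ⌊x / ε⌋ < ⌊y / ε⌋ + 2 := by exact_mod_cast this
      omega
  exact ⟨key _ _ hr, key _ _ hi⟩

lemma cell_dist {ε : ℝ} (hε : 0 < ε) (k k' : ℤ × ℤ) (h1 : |k.1 - k'.1| ≤ 1) (h2 : |k.2 - k'.2| ≤ 1)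
    (z w : ℂ) (hz : z ∈ CellS ε k) (hw : w ∈ CellS ε k') : dist z w ≤ 4 * ε := by
  rw [mem_cellS] at hz hw
  rw [abs_le] at h1 h2
  have c1 : (k.1 : ℝ) ≤ k'.1 + 1 := by exact_mod_cast (by omega : k.1 ≤ k'.1 + 1)
  have c2 : (k'.1 : ℝ) ≤ k.1 + 1 := by exact_mod_cast (by omega : k'.1 ≤ k.1 + 1)
  have c3 : (k.2 : ℝ) ≤ k'.2 + 1 := by exact_mod_cast (by omega : k.2 ≤ k'.2 + 1)
  have c4 : (k'.2 : ℝ) ≤ k.2 + 1 := by exact_mod_cast (by omega : k'.2 ≤ k.2 + 1)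
  obtain ⟨z1, z2, z3, z4⟩ := hz
  obtain ⟨w1, w2, w3, w4⟩ := hw
  rw [Complex.dist_eq]
  have := Complex.norm_le_abs_re_add_abs_im (z - w)
  simp only [Complex.sub_re, Complex.sub_im] at this
  have hr : |z.re - w.re| ≤ 2 * ε := by rw [abs_le]; constructor <;> nlinarith
  have hi : |z.im - w.im| ≤ 2 * ε := by rw [abs_le]; constructor <;> nlinarith
  linarith

lemma cell_close {ε : ℝ} (hε : 0 < ε) (k k' : ℤ × ℤ) (z : ℂ) (hz : z ∈ CellS ε k)
    (hw : z ∈ CellS ε k') : |k.1 - k'.1| ≤ 1 ∧ |k.2 - k'.2| ≤ 1 := by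
  rw [mem_cellS] at hz hw
  obtain ⟨z1, z2, z3, z4⟩ := hz
  obtain ⟨w1, w2, w3, w4⟩ := hw
  have key : ∀ a b : ℤ, ε * a ≤ ε * (b + 1) → a ≤ b + 1 := by
    intro a b h
    have := le_of_mul_le_mul_left h hε
    exact_mod_cast this
  have := key _ _ (z1.trans w2)
  have := key _ _ (w1.trans z2)
  have := key _ _ (z3.trans w4)
  have := key _ _ (w3.trans z4)
  constructor <;> rw [abs_le] <;> constructor <;> omega

lemma cell_convex (ε : ℝ) (k : ℤ × ℤ) : Convex ℝ (CellS ε k) := by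
  have : CellS ε k = {z : ℂ | ε * k.1 ≤ z.re} ∩ ({z : ℂ | z.re ≤ ε * (k.1 + 1)} ∩
    ({z : ℂ | ε * k.2 ≤ z.im} ∩ {z : ℂ | z.im ≤ ε * (k.2 + 1)})) := by
    ext z; simp [mem_cellS]
  rw [this]
  exact (convex_halfSpace_re_ge _).inter ((convex_halfSpace_re_le _).inter
    ((convex_halfSpace_im_ge _).inter (convex_halfSpace_im_le _)))

lemma cell_closed (ε : ℝ) (k : ℤ × ℤ) : IsClosed (CellS ε k) := by
  have : CellS ε k = {z : ℂ | ε * k.1 ≤ z.re} ∩ ({z : ℂ | z.re ≤ ε * (k.1 + 1)} ∩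
    ({z : ℂ | ε * k.2 ≤ z.im} ∩ {z : ℂ | z.im ≤ ε * (k.2 + 1)})) := by
    ext z; simp [mem_cellS]
  rw [this]
  exact (isClosed_le continuous_const Complex.continuous_re).inter
   ((isClosed_le Complex.continuous_re continuous_const).inter
    ((isClosed_le continuous_const Complex.continuous_im).inter
     (isClosed_le Complex.continuous_im continuous_const)))

lemma cell_compact {ε : ℝ} (hε : 0 < ε) (k : ℤ × ℤ) : IsCompact (CellS ε k) := by
  refine Metric.isCompact_of_isClosed_isBounded (cell_closed ε k) ?_
  refine Metric.isBounded_closedBall (x := ptC ε k) (r := 4 * ε) |>.subset ?_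
  intro z hz
  exact cell_dist hε k k (by simp) (by simp) z _ hz (ptC_mem hε k)

lemma cell_locfin {ε : ℝ} (hε : 0 < ε) : LocallyFinite (CellS ε) := by
  intro x
  refine ⟨Metric.ball x ε, Metric.ball_mem_nhds x hε, ?_⟩
  have : ((Set.Icc ((fcell ε x).1 - 2) ((fcell ε x).1 + 2)) ×ˢ
     (Set.Icc ((fcell ε x).2 - 2) ((fcell ε x).2 + 2))).Finite :=
     (Set.finite_Icc _ _).prod (Set.finite_Icc _ _)
  refine this.subset ?_
  rintro k ⟨z, hz, hzx⟩
  have h1 := cell_close hε k _ z hz (fcell_mem hε z)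
  have h2 := fcell_near hε z x hzx
  simp only [abs_le] at h1 h2
  simp only [Set.mem_prod, Set.mem_Icc]
  omega

lemma fat_conn (U : Set ℂ) (hU : IsOpen U) (hUc : IsConnected U) (M : Set ℂ) (hM : IsCompact M)
    (hMU : M ⊆ U) : ∃ M' : Set ℂ, IsCompact M' ∧ IsPreconnected M' ∧ M'.Nonempty ∧ M ⊆ M' ∧ M' ⊆ U := by
  obtain ⟨u, hu⟩ := hUc.nonempty
  have hp : IsPathConnected U := (hU.isConnected_iff_isPathConnected).1 hUc
  suffices h : ∃ M' : Set ℂ, IsCompact M' ∧ IsPreconnected M' ∧ u ∈ M' ∧ M ⊆ M' ∧ M' ⊆ U by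
    obtain ⟨M', h1, h2, h3, h4, h5⟩ := h
    exact ⟨M', h1, h2, ⟨u, h3⟩, h4, h5⟩
  refine hM.induction_on (p := fun s => ∃ M' : Set ℂ, IsCompact M' ∧ IsPreconnected M' ∧ u ∈ M' ∧ s ⊆ M' ∧ M' ⊆ U) ?_ ?_ ?_ ?_
  · exact ⟨{u}, isCompact_singleton, isPreconnected_singleton, rfl, by simp, by simpa using hu⟩
  · rintro s t hst ⟨M', h1, h2, h3, h4, h5⟩
    exact ⟨M', h1, h2, h3, hst.trans h4, h5⟩
  · rintro s t ⟨M', h1, h2, h3, h4, h5⟩ ⟨M'', k1, k2, k3, k4, k5⟩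
    exact ⟨M' ∪ M'', h1.union k1, h2.union u h3 k3 k2, Or.inl h3, Set.union_subset_union h4 k4,
      Set.union_subset h5 k5⟩
  · intro x hx
    obtain ⟨r, hr, hrU⟩ := Metric.nhds_basis_closedBall.mem_iff.1 (hU.mem_nhds (hMU hx))
    obtain ⟨g, hg⟩ := hp.joinedIn u hu x (hMU hx)
    refine ⟨Metric.closedBall x r, mem_nhdsWithin_of_mem_nhds (Metric.closedBall_mem_nhds x hr),
      Set.range g ∪ Metric.closedBall x r, (isCompact_range g.continuous).union (isCompact_closedBall x r),
      (isPreconnected_range g.continuous).union x ⟨1, g.target⟩ (Metric.mem_closedBall_self hr.le)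
        (convex_closedBall x r).isPreconnected, Or.inl ⟨0, g.source⟩, Set.subset_union_right, ?_⟩
    refine Set.union_subset ?_ hrU
    rintro _ ⟨t, rfl⟩
    exact hg t



def EdgeSet (ε : ℝ) (M : Set ℂ) : Set (ℤ × ℤ) :=
  {e | (e.1 + e.2) % 2 = 1 ∧ ∃ z ∈ M, |e.1 - (fcell ε z).1| ≤ 1 ∧ |e.2 - (fcell ε z).2| ≤ 1}

lemma edge_star {ε : ℝ} {M : Set ℂ} (z : ℂ) (hz : z ∈ M) (e e' : ℤ × ℤ)
    (he : (e.1 + e.2) % 2 = 1) (he' : (e'.1 + e'.2) % 2 = 1)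
    (h1 : |e.1 - (fcell ε z).1| ≤ 1) (h2 : |e.2 - (fcell ε z).2| ≤ 1)
    (h1' : |e'.1 - (fcell ε z).1| ≤ 1) (h2' : |e'.2 - (fcell ε z).2| ≤ 1) :
    Relation.ReflTransGen (fun a b => a ∈ EdgeSet ε M ∧ b ∈ EdgeSet ε M ∧ DiagAdj a b) e e' := by
  obtain ⟨m, m1, m2, m3, m4, m5⟩ := star_conn (fcell ε z) e e' he he' h1 h2 h1' h2'
  have hm : m ∈ EdgeSet ε M := ⟨m1, z, hz, m2, m3⟩
  have hee : e ∈ EdgeSet ε M := ⟨he, z, hz, h1, h2⟩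
  have hee' : e' ∈ EdgeSet ε M := ⟨he', z, hz, h1', h2'⟩
  have s1 : Relation.ReflTransGen (fun a b => a ∈ EdgeSet ε M ∧ b ∈ EdgeSet ε M ∧ DiagAdj a b) e m := by
    rcases m4 with rfl | m4
    · exact .refl
    · exact .single ⟨hee, hm, m4⟩
  have s2 : Relation.ReflTransGen (fun a b => a ∈ EdgeSet ε M ∧ b ∈ EdgeSet ε M ∧ DiagAdj a b) m e' := by
    rcases m5 with rfl | m5
    · exact .refl
    · exact .single ⟨hm, hee', m5⟩
  exact s1.trans s2

lemma edge_conn {ε : ℝ} (hε : 0 < ε) {M : Set ℂ} (hM : IsPreconnected M) (e e' : ℤ × ℤ)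
    (he : e ∈ EdgeSet ε M) (he' : e' ∈ EdgeSet ε M) :
    Relation.ReflTransGen (fun a b => a ∈ EdgeSet ε M ∧ b ∈ EdgeSet ε M ∧ DiagAdj a b) e e' := by
  obtain ⟨o, z, hz, z1, z2⟩ := he
  obtain ⟨o', z', hz', z1', z2'⟩ := he'
  let P : ℂ → ℂ → Prop := fun z z' => ∀ e e' : ℤ × ℤ, (e.1 + e.2) % 2 = 1 → (e'.1 + e'.2) % 2 = 1 →
    |e.1 - (fcell ε z).1| ≤ 1 → |e.2 - (fcell ε z).2| ≤ 1 →
    |e'.1 - (fcell ε z').1| ≤ 1 → |e'.2 - (fcell ε z').2| ≤ 1 →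
    Relation.ReflTransGen (fun a b => a ∈ EdgeSet ε M ∧ b ∈ EdgeSet ε M ∧ DiagAdj a b) e e'
  have hloc : ∀ x ∈ M, ∀ y ∈ M, dist x y < ε → P x y := by
    intro x hx y hy hxy e e' oe oe' a1 a2 b1 b2
    obtain ⟨n1, n2⟩ := fcell_near hε x y hxy
    obtain ⟨m, m1, m2, m3, m4, m5⟩ := star_common (fcell ε x) (fcell ε y) n1 n2
    exact (edge_star x hx e m oe m1 a1 a2 m2 m3).trans (edge_star y hy m e' m1 oe' m4 m5 b1 b2)
  have hP : P z z' := by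
    refine hM.induction₂' P ?_ ?_ hz hz'
    · intro x hx
      filter_upwards [self_mem_nhdsWithin, mem_nhdsWithin_of_mem_nhds (Metric.ball_mem_nhds x hε)] with y hy hyx
      exact ⟨hloc x hx y hy (by rw [dist_comm]; exact hyx), hloc y hy x hx hyx⟩
    · intro x y w hx hy hw hxy hyw e e' oe oe' a1 a2 b1 b2
      obtain ⟨m, m1, m2, m3, -, -⟩ := star_common (fcell ε y) (fcell ε y) (by simp) (by simp)
      exact (hxy e m oe m1 a1 a2 m2 m3).trans (hyw m e' m1 oe' m2 m3 b1 b2)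
  exact hP e e' o o' z1 z2 z1' z2'

lemma Gr_unit (c : ℤ → ℤ → Bool) (p q : ℤ × ℤ) (h : (Gr c).Adj p q) : UnitStep p q := by
  rcases h with h | h | h | h <;> simp only [UnitStep] <;> omega

lemma seg_cell {ε : ℝ} (hε : 0 < ε) (c : ℤ → ℤ → Bool) (p q : ℤ × ℤ) (h : (Gr c).Adj p q) :
    ∃ k k' : ℤ × ℤ, c k.1 k.2 ≠ c k'.1 k'.2 ∧ segment ℝ (ptC ε p) (ptC ε q) ⊆ CellS ε k ∧
      segment ℝ (ptC ε p) (ptC ε q) ⊆ CellS ε k' := by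
  have key : ∀ k : ℤ × ℤ, k.1 ≤ p.1 → p.1 ≤ k.1 + 1 → k.2 ≤ p.2 → p.2 ≤ k.2 + 1 →
      k.1 ≤ q.1 → q.1 ≤ k.1 + 1 → k.2 ≤ q.2 → q.2 ≤ k.2 + 1 →
      segment ℝ (ptC ε p) (ptC ε q) ⊆ CellS ε k := by
    intro k a1 a2 a3 a4 b1 b2 b3 b4
    have hh : ∀ r : ℤ × ℤ, k.1 ≤ r.1 → r.1 ≤ k.1 + 1 → k.2 ≤ r.2 → r.2 ≤ k.2 + 1 → ptC ε r ∈ CellS ε k := by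
      intro r r1 r2 r3 r4
      rw [mem_cellS]
      simp only [ptC]
      refine ⟨?_, ?_, ?_, ?_⟩ <;> refine mul_le_mul_of_nonneg_left ?_ hε.le <;> exact_mod_cast by assumption
    exact (cell_convex ε k).segment_subset (hh p a1 a2 a3 a4) (hh q b1 b2 b3 b4)
  rcases h with ⟨h1, h2, h⟩ | ⟨h1, h2, h⟩ | ⟨h1, h2, h⟩ | ⟨h1, h2, h⟩
  · exact ⟨(p.1, p.2), (p.1, p.2 - 1), h, by apply key <;> simp only <;> omega, by apply key <;> simp only <;> omega⟩
  · exact ⟨(q.1, q.2), (q.1, q.2 - 1), h, by apply key <;> simp only <;> omega, by apply key <;> simp only <;> omega⟩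
  · exact ⟨(p.1, p.2), (p.1 - 1, p.2), h, by apply key <;> simp only <;> omega, by apply key <;> simp only <;> omega⟩
  · exact ⟨(q.1, q.2), (q.1 - 1, q.2), h, by apply key <;> simp only <;> omega, by apply key <;> simp only <;> omega⟩

lemma seg_h {ε : ℝ} (hε : 0 < ε) (p : ℤ × ℤ) (z : ℂ) (h1 : ε * p.1 ≤ z.re) (h2 : z.re ≤ ε * (p.1 + 1))
    (h3 : z.im = ε * p.2) : z ∈ segment ℝ (ptC ε p) (ptC ε (p.1 + 1, p.2)) := by
  rw [segment_eq_image']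
  refine ⟨(z.re - ε * p.1) / ε, ⟨div_nonneg (by linarith) hε.le, (div_le_one hε).2 (by linarith)⟩, ?_⟩
  apply Complex.ext
  · simp [ptC]; field_simp; ring
  · simp [ptC, h3]

lemma seg_v {ε : ℝ} (hε : 0 < ε) (p : ℤ × ℤ) (z : ℂ) (h1 : ε * p.2 ≤ z.im) (h2 : z.im ≤ ε * (p.2 + 1))
    (h3 : z.re = ε * p.1) : z ∈ segment ℝ (ptC ε p) (ptC ε (p.1, p.2 + 1)) := by
  rw [segment_eq_image']
  refine ⟨(z.im - ε * p.2) / ε, ⟨div_nonneg (by linarith) hε.le, (div_le_one hε).2 (by linarith)⟩, ?_⟩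
  apply Complex.ext
  · simp [ptC, h3]
  · simp [ptC]; field_simp; ring

lemma meet_side {ε : ℝ} (hε : 0 < ε) (c : ℤ → ℤ → Bool) (k k' : ℤ × ℤ) (hc : c k.1 k.2 ≠ c k'.1 k'.2)
    (z : ℂ) (hz : z ∈ CellS ε k) (hz' : z ∈ CellS ε k')
    (h : k.1 = k'.1 ∨ k.2 = k'.2) :
    ∃ p q, (Gr c).Adj p q ∧ z ∈ segment ℝ (ptC ε p) (ptC ε q) := by
  have hcl := cell_close hε k k' z hz hz'
  simp only [abs_le] at hcl
  -- reduce to ordered version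
  have main : ∀ k k' : ℤ × ℤ, c k.1 k.2 ≠ c k'.1 k'.2 → z ∈ CellS ε k → z ∈ CellS ε k' →
     ((k.1 = k'.1 ∧ k.2 = k'.2 + 1) ∨ (k.2 = k'.2 ∧ k.1 = k'.1 + 1)) →
      ∃ p q, (Gr c).Adj p q ∧ z ∈ segment ℝ (ptC ε p) (ptC ε q) := by
    rintro k k' hc hz hz' (⟨e1, e2⟩ | ⟨e1, e2⟩)
    · refine ⟨k, (k.1 + 1, k.2), Or.inl ⟨rfl, rfl, ?_⟩, ?_⟩
      · rw [e1, e2] at hc ⊢; simpa using hc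
      · rw [mem_cellS] at hz hz'
        refine seg_h hε k z hz.1 hz.2.1 ?_
        have := hz'.2.2.2
        have h2 : (k.2 : ℝ) = k'.2 + 1 := by exact_mod_cast e2
        rw [← h2] at this
        exact le_antisymm this hz.2.2.1
    · refine ⟨k, (k.1, k.2 + 1), Or.inr (Or.inr (Or.inl ⟨rfl, rfl, ?_⟩)), ?_⟩
      · rw [e1, e2] at hc ⊢; simpa using hc
      · rw [mem_cellS] at hz hz'
        refine seg_v hε k z hz.2.2.1 hz.2.2.2 ?_
        have := hz'.2.1
        have h2 : (k.1 : ℝ) = k'.1 + 1 := by exact_mod_cast e2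
        rw [← h2] at this
        exact le_antisymm this hz.1
  by_cases h1 : k.1 = k'.1
  · by_cases h2 : k.2 = k'.2
    · rw [h1, h2] at hc; exact absurd rfl hc
    · by_cases h3 : k.2 = k'.2 + 1
      · exact main k k' hc hz hz' (Or.inl ⟨h1, h3⟩)
      · exact main k' k hc.symm hz' hz (Or.inl ⟨h1.symm, by omega⟩)
  · have h2 : k.2 = k'.2 := by tauto
    by_cases h3 : k.1 = k'.1 + 1
    · exact main k k' hc hz hz' (Or.inr ⟨h2, h3⟩)
    · exact main k' k hc.symm hz' hz (Or.inr ⟨h2.symm, by omega⟩)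

lemma meet_all {ε : ℝ} (hε : 0 < ε) (c : ℤ → ℤ → Bool) (k k' : ℤ × ℤ) (hc : c k.1 k.2 ≠ c k'.1 k'.2)
    (z : ℂ) (hz : z ∈ CellS ε k) (hz' : z ∈ CellS ε k') :
    ∃ p q, (Gr c).Adj p q ∧ z ∈ segment ℝ (ptC ε p) (ptC ε q) := by
  have h3 : z ∈ CellS ε (k.1, k'.2) := by
    rw [mem_cellS] at *
    exact ⟨hz.1, hz.2.1, hz'.2.2.1, hz'.2.2.2⟩
  by_cases h : c k.1 k.2 = c k.1 k'.2
  · exact meet_side hε c (k.1, k'.2) k' (by simp only; rw [← h]; exact hc) z h3 hz' (Or.inr rfl)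
  · exact meet_side hε c k (k.1, k'.2) h z hz h3 (Or.inl rfl)


theorem planar_core (A B : Set ℂ) (hA : IsCompact A) (hAne : A.Nonempty) (hB : IsClosed B)
    (hd : Disjoint A B) (hU : IsConnected (A ∪ B)ᶜ) :
    ∃ γ : ℝ → ℂ, IsJordanLoop γ ∧ γ '' Set.Icc 0 1 ⊆ (A ∪ B)ᶜ ∧
      ∃ C1 C2 : Set ℂ, IsCompact C1 ∧ IsClosed C2 ∧ C1 ∪ C2 = Set.univ ∧
        C1 ∩ C2 ⊆ γ '' Set.Icc 0 1 ∧ A ⊆ C1 ∧ B ⊆ C2 := by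
  have hUo : IsOpen (A ∪ B)ᶜ := (hA.isClosed.union hB).isOpen_compl
  -- distance between A and B
  obtain ⟨d, hd0, hdB⟩ : ∃ d > 0, ∀ b ∈ B, d < Metric.infDist b A := by
    obtain ⟨δ, h0, h⟩ := hA.exists_cthickening_subset_open hB.isOpen_compl hd.subset_compl_right
    refine ⟨δ, h0, fun b hb => ?_⟩
    by_contra hc
    push Not at hc
    obtain ⟨a, ha, hab⟩ := hA.exists_infDist_eq_dist hAne b
    exact h (Metric.mem_cthickening_of_dist_le b a δ A ha (hab ▸ hc)) hb
  have hnear : ∀ z w : ℂ, Metric.infDist z A ≤ Metric.infDist w A + dist z w := fun z w =>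
    Metric.infDist_le_infDist_add_dist
  have hAz : ∀ a ∈ A, Metric.infDist a A = 0 := fun a ha => Metric.infDist_zero_of_mem ha
  -- the shell
  let M : Set ℂ := {z | d / 3 ≤ Metric.infDist z A ∧ Metric.infDist z A ≤ 2 * d / 3}
  have hMcl : IsClosed M := (isClosed_le continuous_const (Metric.continuous_infDist_pt A)).inter
    (isClosed_le (Metric.continuous_infDist_pt A) continuous_const)
  have hMc : IsCompact M := by
    refine (hA.cthickening (r := d)).of_isClosed_subset hMcl ?_
    intro z hz
    obtain ⟨a, ha, hab⟩ := hA.exists_infDist_eq_dist hAne z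
    refine Metric.mem_cthickening_of_dist_le z a d A ha ?_
    rw [← hab]; linarith [hz.2]
  have hMU : M ⊆ (A ∪ B)ᶜ := by
    rintro z hz (h | h)
    · have := hAz z h; linarith [hz.1]
    · have := hdB z h; linarith [hz.2]
  obtain ⟨M', hM'c, hM'p, ⟨u, hu⟩, hMM', hM'U⟩ := fat_conn _ hUo hU M hMc hMU
  obtain ⟨η, hη0, hη⟩ := hM'c.exists_cthickening_subset_open hUo hM'U
  -- mesh
  obtain ⟨ε, hε, hεd, hεη⟩ : ∃ ε : ℝ, 0 < ε ∧ 24 * ε < d ∧ 8 * ε < η := by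
    refine ⟨min (d / 48) (η / 16), by positivity, ?_, ?_⟩
    · have := min_le_left (d / 48) (η / 16); linarith
    · have := min_le_right (d / 48) (η / 16); linarith
  -- bound
  obtain ⟨R, hR⟩ : ∃ R : ℝ, ∀ z ∈ M' ∪ A, |z.re| ≤ R ∧ |z.im| ≤ R := by
    obtain ⟨R, hR⟩ := (hM'c.union hA).isBounded.exists_norm_le
    exact ⟨R, fun z hz => ⟨(Complex.abs_re_le_norm z).trans (hR z hz), (Complex.abs_im_le_norm z).trans (hR z hz)⟩⟩
  obtain ⟨N, hN⟩ : ∃ N : ℤ, R + d < ε * N := by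
    obtain ⟨N, hN⟩ := exists_nat_gt ((R + d) / ε)
    refine ⟨N, ?_⟩
    rw [div_lt_iff₀ hε] at hN
    push_cast; linarith
  set E := EdgeSet ε M' with hEdef
  classical
  let f : ℤ → ℤ → Bool := fun i j => decide (Metric.infDist (ptC ε (i, j)) A < d / 2)
  have hEnear : ∀ e ∈ E, ∃ z ∈ M', dist (ptC ε e) z ≤ 4 * ε := by
    rintro e ⟨-, z, hz, h1, h2⟩
    exact ⟨z, hz, cell_dist hε e _ h1 h2 _ _ (ptC_mem hε e) (fcell_mem hε z)⟩
  have hEM : ∀ i j : ℤ, (i + j) % 2 = 1 → (i, j) ∉ E → ptC ε (i, j) ∉ M' := by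
    intro i j ho hn hm
    refine hn ⟨ho, _, hm, ?_, ?_⟩ <;> rw [fcell_ptC hε] <;> simp
  have hfar : ∀ (p z : ℂ) (r : ℝ), r ≤ d → z ∈ M' ∪ A → dist p z ≤ r → |p.re| < ε * N ∧ |p.im| < ε * N := by
    intro p z r hr hz hp
    rw [Complex.dist_eq] at hp
    have a1 := Complex.abs_re_le_norm (p - z)
    have a2 := Complex.abs_im_le_norm (p - z)
    simp only [Complex.sub_re, Complex.sub_im] at a1 a2
    have b1 := abs_sub_abs_le_abs_sub p.re z.re
    have b2 := abs_sub_abs_le_abs_sub p.im z.im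
    have := hR z hz
    constructor <;> linarith
  have hbox : ∀ i j : ℤ, (N < |i| ∨ N < |j|) → ¬ (|(ptC ε (i, j)).re| < ε * N ∧ |(ptC ε (i, j)).im| < ε * N) := by
    rintro i j h ⟨h1, h2⟩
    simp only [ptC, abs_mul, abs_of_pos hε] at h1 h2
    have h1 := lt_of_mul_lt_mul_left h1 hε.le
    have h2 := lt_of_mul_lt_mul_left h2 hε.le
    have h1 : |i| < N := by exact_mod_cast h1
    have h2 : |j| < N := by exact_mod_cast h2
    omega
  have hNN : ∀ i j : ℤ, (N < |i| ∨ N < |j|) → (i, j) ∉ E ∧ f i j = false := by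
    intro i j h
    constructor
    · intro he
      obtain ⟨z, hz, hzz⟩ := hEnear _ he
      exact hbox i j h (hfar _ z (4 * ε) (by linarith) (Or.inl hz) hzz)
    · simp only [f, decide_eq_false_iff_not]
      intro hlt
      obtain ⟨a, ha, hab⟩ := hA.exists_infDist_eq_dist hAne (ptC ε (i, j))
      exact hbox i j h (hfar _ a (d / 2) (by linarith) (Or.inr ha) (by linarith))
  obtain ⟨e₀, ho, he₁, he₂, -, -⟩ := star_common (fcell ε u) (fcell ε u) (by simp) (by simp)
  have he₀ : e₀ ∈ E := ⟨ho, u, hu, he₁, he₂⟩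
  have hcons : ∀ a b a' b', (a + b) % 2 = 1 → DiagAdj (a, b) (a', b') → (a, b) ∉ E → (a', b') ∉ E →
      f a b = f a' b' := by
    intro a b a' b' hab hD h1 h2
    have hab' : (a' + b') % 2 = 1 := by simp only [DiagAdj] at hD; omega
    have k1 : ptC ε (a, b) ∉ M := fun h => hEM a b hab h1 (hMM' h)
    have k2 : ptC ε (a', b') ∉ M := fun h => hEM a' b' hab' h2 (hMM' h)
    simp only [M, Set.mem_ofPred_eq, not_and, not_le] at k1 k2
    have hdist : dist (ptC ε (a, b)) (ptC ε (a', b')) ≤ 4 * ε := by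
      refine cell_dist hε (a, b) (a', b') ?_ ?_ _ _ (ptC_mem hε _) (ptC_mem hε _) <;>
        simp only [DiagAdj] at hD <;> rw [abs_le] <;> simp only <;> omega
    have n1 := hnear (ptC ε (a, b)) (ptC ε (a', b'))
    have n2 := hnear (ptC ε (a', b')) (ptC ε (a, b))
    rw [dist_comm] at n2
    simp only [f, decide_eq_decide]
    constructor
    · intro hlt
      by_contra hge
      have := k2 (by linarith)
      have h3 : Metric.infDist (ptC ε (a, b)) A < d / 3 := by
        by_contra h4
        have := k1 (by linarith)
        linarith
      linarith
    · intro hlt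
      by_contra hge
      have := k1 (by linarith)
      have h3 : Metric.infDist (ptC ε (a', b')) A < d / 3 := by
        by_contra h4
        have := k2 (by linarith)
        linarith
      linarith
  obtain ⟨c, hc, hfin, hcyc, ⟨w, hw⟩, hreach⟩ := comb2 f E (fun i j h => h.1) e₀ he₀ hcons N
    (fun i j _ h => hNN i j h) (fun e he => edge_conn hε hM'p e₀ e he₀ he)
  -- colours
  have hcol : ∀ (k : ℤ × ℤ) (b : Bool), (∀ a b', (a + b') % 2 = 1 → |a - k.1| ≤ 1 → |b' - k.2| ≤ 1 →
      (a, b') ∉ E ∧ f a b' = b) → c k.1 k.2 = b := by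
    intro k b h
    rw [hc, base_unif f E k.1 k.2 b h]
    intro hk
    exact (h k.1 k.2 hk.1 (by simp) (by simp)).1 hk
  have hnE : ∀ (k e : ℤ × ℤ) (z : ℂ), z ∈ CellS ε k → z ∈ A ∪ B → |e.1 - k.1| ≤ 1 → |e.2 - k.2| ≤ 1 →
      e ∉ E := by
    intro k e z hz hzAB h1 h2 he
    obtain ⟨x, hx, hxe⟩ := hEnear e he
    have h3 := cell_dist hε e k h1 h2 _ _ (ptC_mem hε e) hz
    have h4 := dist_triangle_left z x (ptC ε e)
    exact hη (Metric.mem_cthickening_of_dist_le z x η M' hx (by linarith)) hzAB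
  have hcA : ∀ (k : ℤ × ℤ) (z : ℂ), z ∈ CellS ε k → z ∈ A → c k.1 k.2 = true := by
    intro k z hz hzA
    refine hcol k true fun a b' ho h1 h2 => ⟨hnE k (a, b') z hz (Or.inl hzA) h1 h2, ?_⟩
    have h3 := cell_dist hε (a, b') k h1 h2 _ _ (ptC_mem hε (a, b')) hz
    have h4 := hnear (ptC ε (a, b')) z
    rw [hAz z hzA] at h4
    simp only [f, decide_eq_true_eq]
    linarith
  have hcB : ∀ (k : ℤ × ℤ) (z : ℂ), z ∈ CellS ε k → z ∈ B → c k.1 k.2 = false := by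
    intro k z hz hzB
    refine hcol k false fun a b' ho h1 h2 => ⟨hnE k (a, b') z hz (Or.inr hzB) h1 h2, ?_⟩
    have h3 := cell_dist hε (a, b') k h1 h2 _ _ (ptC_mem hε (a, b')) hz
    have h4 := hnear z (ptC ε (a, b'))
    rw [dist_comm] at h4
    have := hdB z hzB
    simp only [f, decide_eq_false_iff_not]
    linarith
  have hcfar : ∀ k : ℤ × ℤ, (N + 1 < |k.1| ∨ N + 1 < |k.2|) → c k.1 k.2 = false := by
    intro k hk
    refine hcol k false fun a b' ho h1 h2 => hNN a b' ?_
    rw [abs_le] at h1 h2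
    simp only [lt_abs] at *
    omega
  obtain ⟨n, p, hn, hp0, hpinj, hpadj, hpall⟩ := gr_cycle (Gr c) hfin hcyc hw hreach
  obtain ⟨γ, hγ, hγim⟩ := poly_loop ε hε n p hn hp0 hpinj (fun i hi => Gr_unit c _ _ (hpadj i hi))
  refine ⟨γ, hγ, ?_, ⋃ k ∈ {k : ℤ × ℤ | c k.1 k.2 = true}, CellS ε k,
    ⋃ k : {k : ℤ × ℤ // c k.1 k.2 = false}, CellS ε k, ?_, ?_, ?_, ?_, ?_, ?_⟩
  · rw [hγim]
    intro z hz
    simp only [Set.mem_iUnion] at hz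
    obtain ⟨i, hi, hz⟩ := hz
    obtain ⟨k, k', hkk, s1, s2⟩ := seg_cell hε c _ _ (hpadj i hi)
    rintro (h | h)
    · exact hkk ((hcA k z (s1 hz) h).trans (hcA k' z (s2 hz) h).symm)
    · exact hkk ((hcB k z (s1 hz) h).trans (hcB k' z (s2 hz) h).symm)
  · refine Set.Finite.isCompact_biUnion ?_ (fun k _ => cell_compact hε k)
    refine ((Set.finite_Icc (-(N+1)) (N+1)).prod (Set.finite_Icc (-(N+1)) (N+1))).subset ?_
    intro k hk
    have hk : c k.1 k.2 = true := hk
    have : ¬ (N + 1 < |k.1| ∨ N + 1 < |k.2|) := fun h => by simp [hcfar k h] at hk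
    simp only [not_or, not_lt, abs_le] at this
    exact ⟨⟨this.1.1, this.1.2⟩, ⟨this.2.1, this.2.2⟩⟩
  · exact ((cell_locfin hε).comp_injective Subtype.val_injective).isClosed_iUnion (fun k => cell_closed ε _)
  · rw [Set.eq_univ_iff_forall]
    intro z
    cases hz : c (fcell ε z).1 (fcell ε z).2
    · exact Or.inr (Set.mem_iUnion.2 ⟨⟨_, hz⟩, fcell_mem hε z⟩)
    · exact Or.inl (Set.mem_biUnion (x := fcell ε z) hz (fcell_mem hε z))
  · rintro z ⟨h1, h2⟩
    simp only [Set.mem_iUnion] at h1 h2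
    obtain ⟨k, hk, hzk⟩ := h1
    obtain ⟨⟨k', hk'⟩, hzk'⟩ := h2
    have hk : c k.1 k.2 = true := hk
    obtain ⟨a, b, hab, hz⟩ := meet_all hε c k k' (by rw [hk, hk']; simp) z hzk hzk'
    rw [hγim]
    simp only [Set.mem_iUnion]
    obtain ⟨i, hi, ⟨ha, hb⟩ | ⟨ha, hb⟩⟩ := hpall a b hab
    · exact ⟨i, hi, by rw [← ha, ← hb]; exact hz⟩
    · exact ⟨i, hi, by rw [← ha, ← hb, segment_symm]; exact hz⟩
  · intro z hz
    exact Set.mem_biUnion (x := fcell ε z) (hcA _ z (fcell_mem hε z) hz) (fcell_mem hε z)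
  · intro z hz
    exact Set.mem_iUnion.2 ⟨⟨_, hcB _ z (fcell_mem hε z) hz⟩, fcell_mem hε z⟩


lemma locConn_sphere : LocallyConnectedSpace (OnePoint ℂ) := by
  have e : OnePoint ℂ ≃ₜ Metric.sphere (0 : EuclideanSpace ℝ (Fin 3)) 1 :=
    onePointEquivSphereOfFinrankEq (by simp)
  have : Fact (Module.finrank ℝ (EuclideanSpace ℝ (Fin 3)) = 2 + 1) := ⟨by simp⟩
  have : LocallyConnectedSpace (Metric.sphere (0 : EuclideanSpace ℝ (Fin 3)) 1) :=
    ChartedSpace.locallyConnectedSpace (EuclideanSpace ℝ (Fin 2)) _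
  exact e.isOpenEmbedding.locallyConnectedSpace

lemma comp_closed (K : Set (OnePoint ℂ)) (hK : IsClosed K) (x : OnePoint ℂ) (hx : x ∈ K) :
    IsClosed (connectedComponentIn K x) := by
  have h1 : closure (connectedComponentIn K x) ⊆ connectedComponentIn K x := by
    refine (isPreconnected_connectedComponentIn.closure).subset_connectedComponentIn
      (subset_closure (mem_connectedComponentIn hx)) ?_
    exact hK.closure_subset_iff.2 (connectedComponentIn_subset K x)
  exact isClosed_of_closure_subset h1

lemma comp_eq {K : Set (OnePoint ℂ)} {C C' : Set (OnePoint ℂ)} (hC : C ∈ Components K)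
    (hC' : C' ∈ Components K) (x : OnePoint ℂ) (hx : x ∈ C) (hx' : x ∈ C') : C = C' := by
  obtain ⟨y, hy, rfl⟩ := hC
  obtain ⟨y', hy', rfl⟩ := hC'
  rw [connectedComponentIn_eq hx, connectedComponentIn_eq hx']

lemma sep_fwd (U A B : Set (OnePoint ℂ)) (hUconn : IsConnected U)
    (hA : IsClosed A) (hB : IsClosed B) (hd : Disjoint A B) (hAB : A ∪ B = Uᶜ) (hAne : A.Nonempty)
    (hinf : ∞ ∈ B) : ∃ γ : ℝ → ℂ, IsJordanLoop γ ∧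
          (fun z : ℂ => (z : OnePoint ℂ)) '' (γ '' Set.Icc 0 1) ⊆ U ∧
          ∀ a ∈ A, ∀ b ∈ B,
            b ∉ connectedComponentIn
              (((fun z : ℂ => (z : OnePoint ℂ)) '' (γ '' Set.Icc 0 1))ᶜ) a := by
  have hUAB : U = (A ∪ B)ᶜ := by rw [hAB, compl_compl]
  have hiA : ∞ ∉ A := fun h => Set.disjoint_left.1 hd h hinf
  have hiU : ∞ ∉ U := by rw [hUAB]; exact fun h => h (Or.inr hinf)
  let q : ℂ → OnePoint ℂ := fun z => (z : OnePoint ℂ)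
  have hqc : Continuous q := OnePoint.continuous_coe
  have hA0 := (OnePoint.isClosed_iff_of_notMem hiA).1 hA
  have hU0 : (q ⁻¹' A ∪ q ⁻¹' B)ᶜ = q ⁻¹' U := by rw [hUAB]; rfl
  have hUim : q '' (q ⁻¹' U) = U := by
    rw [Set.image_preimage_eq_iff]
    intro x hx
    induction x using OnePoint.rec with
    | infty => exact absurd hx hiU
    | coe z => exact ⟨z, rfl⟩
  have hUc : IsConnected (q ⁻¹' A ∪ q ⁻¹' B)ᶜ := by
    rw [hU0]
    have hne : (q ⁻¹' U).Nonempty := by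
      have := hUconn.nonempty
      rw [← hUim] at this
      exact Set.image_nonempty.1 this
    refine ⟨hne, ?_⟩
    rw [← OnePoint.isOpenEmbedding_coe.isInducing.isPreconnected_image]
    have h5 := hUconn.isPreconnected
    rw [← hUim] at h5
    exact h5
  have hAne0 : (q ⁻¹' A).Nonempty := by
    obtain ⟨x, hx⟩ := hAne
    induction x using OnePoint.rec with
    | infty => exact absurd hx hiA
    | coe z => exact ⟨z, hx⟩
  have hd0 : Disjoint (q ⁻¹' A) (q ⁻¹' B) := hd.preimage q
  obtain ⟨γ, hγ, hγU, C1, C2, hC1, hC2, hcov, hint, hAC, hBC⟩ :=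
    planar_core _ _ hA0.2 hAne0 (hB.preimage hqc) hd0 hUc
  rw [hU0] at hγU
  refine ⟨γ, hγ, ?_, ?_⟩
  · rintro _ ⟨z, hz, rfl⟩
    exact hγU hz
  intro a ha b hb hba
  have hc1 : IsClosed (q '' C1) := (hC1.image hqc).isClosed
  have hc2 : IsClosed (q '' C2 ∪ {∞}) := by
    have : q '' C2 ∪ {∞} = (q '' C2ᶜ)ᶜ := by
      ext x
      induction x using OnePoint.rec with
      | infty => simp [q]
      | coe z => simp [q]
    rw [this]
    exact (OnePoint.isOpenEmbedding_coe.isOpenMap _ hC2.isOpen_compl).isClosed_compl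
  set F := (q '' (γ '' Set.Icc 0 1))ᶜ with hF
  have haF : a ∈ F := by
    rintro ⟨z, hz, rfl⟩
    have : q z ∈ U := hγU hz
    rw [hUAB] at this
    exact this (Or.inl ha)
  have hp : IsPreconnected (connectedComponentIn F a) := isPreconnected_connectedComponentIn
  rw [isPreconnected_closed_iff] at hp
  have hsub : connectedComponentIn F a ⊆ q '' C1 ∪ (q '' C2 ∪ {∞}) := by
    intro x _
    induction x using OnePoint.rec with
    | infty => exact Or.inr (Or.inr rfl)
    | coe z =>
      have : z ∈ C1 ∪ C2 := hcov ▸ Set.mem_univ z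
      rcases this with h | h
      · exact Or.inl ⟨z, h, rfl⟩
      · exact Or.inr (Or.inl ⟨z, h, rfl⟩)
  have ha1 : a ∈ q '' C1 := by
    induction a using OnePoint.rec with
    | infty => exact absurd ha hiA
    | coe z => exact ⟨z, hAC ha, rfl⟩
  have hb2 : b ∈ q '' C2 ∪ {∞} := by
    induction b using OnePoint.rec with
    | infty => exact Or.inr rfl
    | coe z => exact Or.inl ⟨z, hBC hb, rfl⟩
  obtain ⟨x, hx, ⟨z, hz1, rfl⟩, hx2⟩ := hp _ _ hc1 hc2 hsub ⟨a, mem_connectedComponentIn haF, ha1⟩ ⟨b, hba, hb2⟩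
  have hz2 : z ∈ C2 := by
    rcases hx2 with ⟨w, hw, hwz⟩ | h
    · rwa [← OnePoint.coe_injective hwz]
    · exact absurd h (OnePoint.coe_ne_infty z)
  exact connectedComponentIn_subset F a hx ⟨z, hint ⟨hz1, hz2⟩, rfl⟩

theorem stmt4 (U : Set (OnePoint ℂ)) (hUo : IsOpen U) (hUconn : IsConnected U)
    (hinf : ∞ ∉ U) (hK : (Uᶜ).Nonempty) :
    (Components Uᶜ).Finite ↔
      ∀ S ⊆ Components Uᶜ, S.Nonempty → (Components Uᶜ \ S).Nonempty →
        ∃ γ : ℝ → ℂ, IsJordanLoop γ ∧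
          (fun z : ℂ => (z : OnePoint ℂ)) '' (γ '' Set.Icc 0 1) ⊆ U ∧
          ∀ a ∈ ⋃₀ S, ∀ b ∈ ⋃₀ (Components Uᶜ \ S),
            b ∉ connectedComponentIn
              (((fun z : ℂ => (z : OnePoint ℂ)) '' (γ '' Set.Icc 0 1))ᶜ) a := by
  have hKc : IsClosed Uᶜ := hUo.isClosed_compl
  have hne : ∀ C ∈ Components Uᶜ, C.Nonempty := by
    rintro C ⟨x, hx, rfl⟩
    exact ⟨x, mem_connectedComponentIn hx⟩
  have hsub : ∀ C ∈ Components Uᶜ, C ⊆ Uᶜ := by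
    rintro C ⟨x, hx, rfl⟩
    exact connectedComponentIn_subset _ _
  constructor
  · intro hfin S hS hSne hSne'
    have hcl : ∀ T ⊆ Components Uᶜ, IsClosed (⋃₀ T) := by
      intro T hT
      rw [Set.sUnion_eq_biUnion]
      refine (hfin.subset hT).isClosed_biUnion ?_
      intro C hC
      obtain ⟨x, hx, rfl⟩ := hT hC
      exact comp_closed _ hKc x hx
    have hnn : ∀ T ⊆ Components Uᶜ, T.Nonempty → (⋃₀ T).Nonempty := by
      rintro T hT ⟨C, hC⟩
      obtain ⟨x, hx⟩ := hne C (hT hC)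
      exact ⟨x, C, hC, hx⟩
    have hd : Disjoint (⋃₀ S) (⋃₀ (Components Uᶜ \ S)) := by
      rw [Set.disjoint_left]
      rintro x ⟨C, hC, hxC⟩ ⟨C', hC', hxC'⟩
      have := comp_eq (hS hC) hC'.1 x hxC hxC'
      exact hC'.2 (this ▸ hC)
    have hcov : ⋃₀ S ∪ ⋃₀ (Components Uᶜ \ S) = Uᶜ := by
      apply Set.Subset.antisymm
      · rintro x (⟨C, hC, hx⟩ | ⟨C, hC, hx⟩)
        · exact hsub C (hS hC) hx
        · exact hsub C hC.1 hx
      · intro x hx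
        by_cases h : connectedComponentIn Uᶜ x ∈ S
        · exact Or.inl ⟨_, h, mem_connectedComponentIn hx⟩
        · exact Or.inr ⟨_, ⟨⟨x, hx, rfl⟩, h⟩, mem_connectedComponentIn hx⟩
    have hiK : ∞ ∈ ⋃₀ S ∪ ⋃₀ (Components Uᶜ \ S) := by rw [hcov]; exact hinf
    rcases hiK with hi | hi
    · obtain ⟨γ, h1, h2, h3⟩ := sep_fwd U _ _ hUconn (hcl _ Set.sdiff_subset) (hcl _ hS) hd.symm
        (by rw [Set.union_comm]; exact hcov) (hnn _ Set.sdiff_subset hSne') hi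
      refine ⟨γ, h1, h2, fun a ha b hb hab => h3 b hb a ha ?_⟩
      rw [← connectedComponentIn_eq hab]
      refine mem_connectedComponentIn ?_
      intro haU
      have : a ∈ Uᶜ := hcov ▸ Or.inl ha
      exact this (h2 haU)
    · exact sep_fwd U _ _ hUconn (hcl _ hS) (hcl _ Set.sdiff_subset) hd hcov (hnn _ hS hSne) hi
  · intro H
    have := locConn_sphere
    have key : ∀ C ∈ Components Uᶜ, ∃ V : Set (OnePoint ℂ), IsOpen V ∧ C ⊆ V ∧ V ∩ Uᶜ ⊆ C := by
      intro C hC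
      by_cases hr : (Components Uᶜ \ {C}).Nonempty
      · obtain ⟨γ, h1, h2, h3⟩ := H {C} (by simpa using hC) (by simp) hr
        set Γ := (fun z : ℂ => (z : OnePoint ℂ)) '' (γ '' Set.Icc 0 1) with hΓ
        have hΓc : IsClosed Γ :=
          ((isCompact_Icc.image_of_continuousOn h1.1).image OnePoint.continuous_coe).isClosed
        refine ⟨⋃ a ∈ C, connectedComponentIn Γᶜ a, ?_, ?_, ?_⟩
        · exact isOpen_biUnion fun a _ => hΓc.isOpen_compl.connectedComponentIn
        · intro a ha
          exact Set.mem_biUnion ha (mem_connectedComponentIn fun h => hsub C hC ha (h2 h))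
        · rintro b ⟨hb, hbK⟩
          simp only [Set.mem_iUnion] at hb
          obtain ⟨a, ha, hb⟩ := hb
          by_contra hbC
          refine h3 a ⟨C, rfl, ha⟩ b ⟨connectedComponentIn Uᶜ b, ⟨⟨b, hbK, rfl⟩, ?_⟩, mem_connectedComponentIn hbK⟩ hb
          intro he
          exact hbC (he ▸ mem_connectedComponentIn hbK)
      · refine ⟨Set.univ, isOpen_univ, Set.subset_univ _, ?_⟩
        rintro b ⟨-, hbK⟩
        by_contra hbC
        refine hr ⟨connectedComponentIn Uᶜ b, ⟨b, hbK, rfl⟩, ?_⟩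
        intro he
        exact hbC (he ▸ mem_connectedComponentIn hbK)
    choose! V hVo hCV hVC using key
    have hcomp : IsCompact Uᶜ := hKc.isCompact
    obtain ⟨t, ht, htf, hcov⟩ := hcomp.elim_finite_subcover_image (b := Components Uᶜ) (c := V) hVo (by
      intro x hx
      exact Set.mem_biUnion (⟨x, hx, rfl⟩ : connectedComponentIn Uᶜ x ∈ Components Uᶜ)
        (hCV _ ⟨x, hx, rfl⟩ (mem_connectedComponentIn hx)))
    refine htf.subset ?_
    intro C hC
    obtain ⟨x, hx⟩ := hne C hC
    have hxK := hsub C hC hx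
    have hx2 := hcov hxK
    simp only [Set.mem_iUnion] at hx2
    obtain ⟨C', hC', hxV⟩ := hx2
    have := comp_eq hC (ht hC') x hx (hVC C' (ht hC') ⟨hxV, hxK⟩)
    exact this ▸ hC'
end

section
/- Let U ⊆ ℂ be open and let γ be a Jordan loop with image contained in U. If every bounded connected component of ℂ ∖ γ '' [0,1] is contained in U, then γ is null-homotopic in U: there exists a continuous map H : [0,1] × [0,1] → U with H(0, t) = γ t and H(1, t) = γ 0 for all t ∈ [0,1], and H(s, 0) = H(s, 1) for all s ∈ [0,1]. -/
open Set

inductive LBad (M : ℤ) (Free : ℤ × ℤ → Prop) : ℤ × ℤ → Prop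
  | far (v : ℤ × ℤ) (h : M < |v.1| ∨ M < |v.2|) : LBad M Free v
  | step (v w : ℤ × ℤ) (h : Free v) (hvw : |v.1 - w.1| + |v.2 - w.2| ≤ 1)
      (hw : LBad M Free w) : LBad M Free v

def latG (Good : ℤ × ℤ → Prop) : SimpleGraph (ℤ × ℤ) where
  Adj u v := Good u ∧ Good v ∧ |u.1 - v.1| + |u.2 - v.2| = 1
  symm := ⟨by
    rintro u v ⟨h1, h2, h3⟩
    refine ⟨h2, h1, ?_⟩
    rw [abs_sub_comm v.1, abs_sub_comm v.2]; exact h3⟩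
  loopless := ⟨by
    rintro u ⟨_, _, h⟩
    simp at h⟩

section Walks
variable {V : Type*} {G : SimpleGraph V}

def wsum {A : Type*} [AddCommMonoid A] (f : V → V → A) : ∀ {u v : V}, G.Walk u v → A
  | _, _, .nil => 0
  | u, _, .cons (v := v) _ p => f u v + wsum f p

theorem wsum_append {A : Type*} [AddCommMonoid A] (f : V → V → A) {u v w : V}
    (p : G.Walk u v) (q : G.Walk v w) :
    wsum f (p.append q) = wsum f p + wsum f q := by
  induction p with
  | nil => simp [wsum]
  | cons h p ih => simp [wsum, ih, add_assoc]

theorem wsum_tele (φ : V → ℤ) {u v : V} (p : G.Walk u v) :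
    wsum (fun a b => φ b - φ a) p = φ v - φ u := by
  induction p with
  | nil => simp [wsum]
  | cons h p ih => simp [wsum, ih]

theorem wsum_congr {f g : V → V → ℤ} {u v : V} (p : G.Walk u v)
    (h : ∀ a b, G.Adj a b → a ∈ p.support → b ∈ p.support → f a b = g a b) :
    wsum f p = wsum g p := by
  induction p with
  | nil => simp [wsum]
  | cons h' p ih =>
    simp only [wsum]
    rw [ih, h _ _ h' (by simp) (by simp)]
    intro a b hab ha hb
    exact h a b hab (by simp [ha]) (by simp [hb])

theorem wsum_zero {u v : V} (p : G.Walk u v) : wsum (fun _ _ => (0 : ℤ)) p = 0 := by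
  induction p with
  | nil => simp [wsum]
  | cons h p ih => simp [wsum, ih]

open CategoryTheory in
def whol {C : Type*} [Groupoid C] (c : V → C) (e : ∀ u v, G.Adj u v → (c u ⟶ c v)) :
    ∀ {u v : V}, G.Walk u v → (c u ⟶ c v)
  | u, _, .nil => 𝟙 (c u)
  | _, _, .cons h p => e _ _ h ≫ whol c e p

open CategoryTheory in
theorem whol_append {C : Type*} [Groupoid C] (c : V → C) (e : ∀ u v, G.Adj u v → (c u ⟶ c v))
    {u v w : V} (p : G.Walk u v) (q : G.Walk v w) :
    whol c e (p.append q) = whol c e p ≫ whol c e q := by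
  induction p with
  | nil => simp [whol]
  | cons h p ih => simp [whol, ih]

end Walks

/-- signed crossing of the vertical ray above `(m,i)`, between columns `m` and `m+1` -/
def crs (q u v : ℤ × ℤ) : ℤ :=
  if u.1 = q.1 ∧ v.1 = q.1 + 1 ∧ q.2 < u.2 then 1
  else if u.1 = q.1 + 1 ∧ v.1 = q.1 ∧ q.2 < u.2 then -1 else 0

theorem adj_cases {u v : ℤ × ℤ} (h : |u.1 - v.1| + |u.2 - v.2| ≤ 1) :
    v = u ∨ v = (u.1 + 1, u.2) ∨ v = (u.1 - 1, u.2) ∨ v = (u.1, u.2 + 1) ∨ v = (u.1, u.2 - 1) := by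
  obtain ⟨a, b⟩ := u
  obtain ⟨c, d⟩ := v
  simp only [Prod.mk.injEq] at *
  rcases abs_cases (a - c) with h1 | h1 <;> rcases abs_cases (b - d) with h2 | h2 <;> omega

theorem crs_up {Good : ℤ × ℤ → Prop} (m i : ℤ) (hq : ¬ Good (m, i + 1)) {u v : ℤ × ℤ}
    (h : (latG Good).Adj u v) : crs (m, i) u v = crs (m, i + 1) u v := by
  obtain ⟨h1, h2, h3⟩ := h
  have e1 : u ≠ (m, i + 1) := by rintro rfl; exact hq h1
  have e2 : v ≠ (m, i + 1) := by rintro rfl; exact hq h2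
  obtain ⟨a, b⟩ := u
  simp only [ne_eq, Prod.mk.injEq] at e1
  rcases adj_cases h3.le with rfl | rfl | rfl | rfl | rfl <;>
  · simp only [ne_eq, Prod.mk.injEq] at e2
    simp only [crs]
    split_ifs <;> omega

theorem crs_left {Good : ℤ × ℤ → Prop} (m i : ℤ) (hq : ¬ Good (m, i)) {u v : ℤ × ℤ}
    (h : (latG Good).Adj u v) : crs (m - 1, i) u v = crs (m, i) u v +
      ((if v.1 = m ∧ i < v.2 then 1 else 0) - (if u.1 = m ∧ i < u.2 then 1 else 0)) := by
  obtain ⟨h1, h2, h3⟩ := h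
  have e1 : u ≠ (m, i) := by rintro rfl; exact hq h1
  have e2 : v ≠ (m, i) := by rintro rfl; exact hq h2
  obtain ⟨a, b⟩ := u
  simp only [ne_eq, Prod.mk.injEq] at e1
  rcases adj_cases h3.le with rfl | rfl | rfl | rfl | rfl <;>
  · simp only [ne_eq, Prod.mk.injEq] at e2
    simp only [crs]
    split_ifs <;> omega

theorem wsum_add_tele {V : Type*} {G : SimpleGraph V} (f : V → V → ℤ) (φ : V → ℤ) {u v : V}
    (p : G.Walk u v) :
    wsum (fun a b => f a b + (φ b - φ a)) p = wsum f p + (φ v - φ u) := by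
  induction p with
  | nil => simp [wsum]
  | cons h p ih => simp only [wsum, ih]; ring

theorem wsum_left {Good : ℤ × ℤ → Prop} (m i : ℤ) (hq : ¬ Good (m, i)) {u : ℤ × ℤ}
    (p : (latG Good).Walk u u) : wsum (crs (m - 1, i)) p = wsum (crs (m, i)) p := by
  rw [wsum_congr p (fun a b hab _ _ => crs_left m i hq hab)]
  have := wsum_add_tele (crs (m, i)) (fun v => if v.1 = m ∧ i < v.2 then 1 else 0) p
  rw [this]; ring

theorem wsum_up {Good : ℤ × ℤ → Prop} (m i : ℤ) (hq : ¬ Good (m, i + 1)) {u : ℤ × ℤ}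
    (p : (latG Good).Walk u u) : wsum (crs (m, i)) p = wsum (crs (m, i + 1)) p :=
  wsum_congr p (fun _ _ hab _ _ => crs_up m i hq hab)

theorem wsum_bad (M : ℤ) (Free : ℤ × ℤ → Prop) (q : ℤ × ℤ) (hq : LBad M Free q) {u : ℤ × ℤ}
    (p : (latG (fun v => ¬ LBad M Free v)).Walk u u) : wsum (crs q) p = 0 := by
  have bd : ∀ v, ¬ LBad M Free v → (-M ≤ v.1 ∧ v.1 ≤ M) ∧ (-M ≤ v.2 ∧ v.2 ≤ M) := by
    intro v hv
    have : ¬ (M < |v.1| ∨ M < |v.2|) := fun h => hv (.far v h)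
    push Not at this
    exact ⟨abs_le.1 this.1, abs_le.1 this.2⟩
  induction hq with
  | far q h =>
    obtain ⟨m, i⟩ := q
    by_cases hi : i < -M
    · have := wsum_tele (fun v : ℤ × ℤ => if m < v.1 then (1:ℤ) else 0) p
      rw [sub_self] at this
      rw [← this]
      apply wsum_congr
      intro a b hab _ _
      have h1 := bd a hab.1
      have h2 := bd b hab.2.1
      obtain ⟨a, a'⟩ := a
      have h3 := hab.2.2
      rcases adj_cases h3.le with rfl | rfl | rfl | rfl | rfl <;>
      · simp only [crs] at *
        split_ifs <;> omega
    · rw [← wsum_zero p]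
      apply wsum_congr
      intro a b hab _ _
      have h1 := bd a hab.1
      have h2 := bd b hab.2.1
      simp only [lt_abs] at h
      simp only [crs]
      split_ifs <;> omega
  | step v w h hvw hw ih =>
    have hv : ¬ (fun v => ¬ LBad M Free v) v := by
      simpa using LBad.step v w h hvw hw
    have hw' : ¬ (fun v => ¬ LBad M Free v) w := by simpa using hw
    obtain ⟨m, i⟩ := v
    rcases adj_cases hvw with rfl | rfl | rfl | rfl | rfl
    · exact ih
    · have := wsum_left (m + 1) i hw' p
      simp only [add_sub_cancel_right] at this
      rw [this]; exact ih
    · rw [← wsum_left m i hv p]; exact ih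
    · rw [wsum_up m i hw' p]; exact ih
    · have := wsum_up m (i - 1) (by simpa using hv) p
      simp only [sub_add_cancel] at this
      rw [← this]; exact ih
open CategoryTheory in
theorem whol_trivial (M : ℤ) (Free : ℤ × ℤ → Prop) {C : Type*} [Groupoid C] (c : ℤ × ℤ → C)
    (e : ∀ u v, (latG (fun v => ¬ LBad M Free v)).Adj u v → (c u ⟶ c v))
    (hinv : ∀ u v (h : (latG (fun v => ¬ LBad M Free v)).Adj u v), e u v h ≫ e v u h.symm = 𝟙 _)
    (hsq : ∀ u v w z (h1 : (latG (fun v => ¬ LBad M Free v)).Adj u v)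
      (h2 : (latG (fun v => ¬ LBad M Free v)).Adj v w)
      (h3 : (latG (fun v => ¬ LBad M Free v)).Adj u z)
      (h4 : (latG (fun v => ¬ LBad M Free v)).Adj z w),
      |v.1 - z.1| ≤ 1 → |v.2 - z.2| ≤ 1 → e u v h1 ≫ e v w h2 = e u z h3 ≫ e z w h4) :
    ∀ n k : ℕ, ∀ u (p : (latG (fun v => ¬ LBad M Free v)).Walk u u), p.length = n →
      wsum (fun a _ => (a.1 + a.2 + 2 * M).toNat) p = k → whol c e p = 𝟙 _ := by
  have bd : ∀ v, ¬ LBad M Free v → (-M ≤ v.1 ∧ v.1 ≤ M) ∧ (-M ≤ v.2 ∧ v.2 ≤ M) := by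
    intro v hv
    have : ¬ (M < |v.1| ∨ M < |v.2|) := fun h => hv (.far v h)
    push Not at this
    exact ⟨abs_le.1 this.1, abs_le.1 this.2⟩
  intro n
  induction n using Nat.strong_induction_on with
  | _ n IHn =>
  intro k
  induction k using Nat.strong_induction_on with
  | _ k IHk =>
  intro u p hlen hwt
  -- lexicographic max
  obtain ⟨m, hm, hmax⟩ := p.support.toFinset.exists_max_image (fun v => toLex (v.2, v.1))
    ⟨u, by simp⟩
  rw [List.mem_toFinset] at hm
  have hmax' : ∀ v ∈ p.support, v.2 < m.2 ∨ (v.2 = m.2 ∧ v.1 ≤ m.1) := by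
    intro v hv
    have := hmax v (by simpa using hv)
    rw [Prod.Lex.toLex_le_toLex] at this
    simpa using this
  clear hmax
  -- split at m
  obtain ⟨a, b, rfl⟩ : ∃ (a : (latG (fun v => ¬ LBad M Free v)).Walk u m)
    (b : (latG (fun v => ¬ LBad M Free v)).Walk m u), p = a.append b :=
    ⟨p.takeUntil m hm, p.dropUntil m hm, (p.take_spec hm).symm⟩
  suffices h : whol c e (b.append a) = 𝟙 _ by
    rw [whol_append] at h ⊢
    have : whol c e a = inv (whol c e b) := by
      rw [← cancel_epi (whol c e b), h]; simp
    rw [this]; simp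
  have hlen' : (b.append a).length = n := by
    simp only [SimpleGraph.Walk.length_append] at hlen ⊢; omega
  have hwt' : wsum (fun a _ => (a.1 + a.2 + 2 * M).toNat) (b.append a) = k := by
    rw [wsum_append] at hwt ⊢; omega
  have hmax : ∀ v ∈ (b.append a).support, v.2 < m.2 ∨ (v.2 = m.2 ∧ v.1 ≤ m.1) := by
    intro v hv
    apply hmax'
    rw [SimpleGraph.Walk.mem_support_append_iff] at hv ⊢
    tauto
  generalize b.append a = p at *
  clear hmax' hlen hwt hm a b
  cases p with
  | nil => simp [whol]
  | @cons _ y _ hy q =>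
  cases q with
  | nil => exact absurd rfl hy.ne
  | cons hc q =>
  obtain ⟨x, d, hx, hd⟩ := SimpleGraph.Walk.exists_cons_eq_concat hc q
  rw [hd] at hlen' hwt' hmax ⊢
  clear hd hc q
  rw [SimpleGraph.Walk.concat_eq_append] at hlen' hwt' hmax ⊢
  have hsup : ∀ v ∈ d.support, v.2 < m.2 ∨ (v.2 = m.2 ∧ v.1 ≤ m.1) := by
    intro v hv
    apply hmax
    rw [SimpleGraph.Walk.support_cons, List.mem_cons, SimpleGraph.Walk.mem_support_append_iff]
    tauto
  have hlen : d.length + 2 = n := by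
    simp at hlen'; omega
  by_cases hmd : m ∈ d.support
  · obtain ⟨a, b, rfl⟩ : ∃ (a : (latG (fun v => ¬ LBad M Free v)).Walk y m)
      (b : (latG (fun v => ¬ LBad M Free v)).Walk m x), d = a.append b :=
      ⟨d.takeUntil m hmd, d.dropUntil m hmd, (d.take_spec hmd).symm⟩
    rw [SimpleGraph.Walk.length_append] at hlen
    have h1 := IHn (SimpleGraph.Walk.cons hy a).length (by simp; omega) _ _ _ rfl rfl
    have h2 := IHn (b.append (SimpleGraph.Walk.cons hx .nil)).length
      (by simp; omega) _ _ _ rfl rfl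
    simp only [whol, whol_append, Category.assoc] at h1 h2 ⊢
    rw [h2, Category.comp_id, h1]
  by_cases hxy : x = y
  · subst hxy
    have h1 := IHn d.length (by omega) _ _ d rfl rfl
    simp only [whol, whol_append]
    rw [h1]
    simpa using hinv _ _ hy
  have hxs := hsup x d.end_mem_support
  have hys := hsup y d.start_mem_support
  have hgx := hx.1
  have hgy := hy.2.1
  have hx3 := hx.symm.2.2
  have hy3 := hy.2.2
  have hgm := hy.1
  have key : ∀ z : ℤ × ℤ, z = (m.1 - 1, m.2 - 1) →
      ((x = (m.1 - 1, m.2) ∧ y = (m.1, m.2 - 1)) ∨ (y = (m.1 - 1, m.2) ∧ x = (m.1, m.2 - 1))) →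
      whol c e (SimpleGraph.Walk.cons hy (d.append (SimpleGraph.Walk.cons hx .nil))) = 𝟙 _ := by
    rintro z hz hcase
    by_cases hgz : LBad M Free z
    · exfalso
      have h0 := wsum_bad M Free z hgz
        (SimpleGraph.Walk.cons hy (d.append (SimpleGraph.Walk.cons hx .nil)))
      simp only [wsum, wsum_append] at h0
      have hd0 : wsum (crs z) d = 0 := by
        rw [← wsum_zero d]
        apply wsum_congr
        intro a b hab ha hb
        have ha' : a ≠ m := by rintro rfl; exact hmd ha
        have hb' : b ≠ m := by rintro rfl; exact hmd hb
        have h1 := hsup a ha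
        have h2 := hsup b hb
        subst hz
        obtain ⟨m1, m2⟩ := m
        obtain ⟨a1, a2⟩ := a
        simp only [ne_eq, Prod.mk.injEq] at ha'
        rcases adj_cases hab.2.2.le with rfl | rfl | rfl | rfl | rfl <;>
        · simp only [ne_eq, Prod.mk.injEq] at hb'
          simp only [crs] at *
          split_ifs <;> omega
      rw [hd0] at h0
      subst hz
      rcases hcase with ⟨hx', hy'⟩ | ⟨hy', hx'⟩ <;>
      · rw [hx', hy'] at h0
        have hne : ¬ (m.1 = m.1 - 1) := by omega
        simp [crs, hne] at h0
    · have hxz : (latG (fun v => ¬ LBad M Free v)).Adj x z := by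
        refine ⟨hgx, hgz, ?_⟩
        rcases hcase with ⟨hx', hy'⟩ | ⟨hy', hx'⟩ <;> · rw [hx', hz]; simp
      have hzy : (latG (fun v => ¬ LBad M Free v)).Adj z y := by
        refine ⟨hgz, hgy, ?_⟩
        rcases hcase with ⟨hx', hy'⟩ | ⟨hy', hx'⟩ <;> · rw [hy', hz]; simp
      have hlt : wsum (fun a _ => (a.1 + a.2 + 2 * M).toNat)
          (SimpleGraph.Walk.cons hxz (SimpleGraph.Walk.cons hzy d)) < k := by
        rw [← hwt']
        simp only [wsum, wsum_append]
        have := bd z hgz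
        have : (z.1 + z.2 + 2 * M).toNat < (m.1 + m.2 + 2 * M).toNat := by
          rw [hz] at this ⊢
          simp only at this ⊢
          omega
        omega
      have := IHk _ hlt _ _ (by simp; omega) rfl
      simp only [whol, whol_append, Category.comp_id] at this ⊢
      rw [← Category.assoc, hsq x z y m hxz hzy hx hy (by rw [hz]; simp) (by rw [hz]; simp), Category.assoc] at this
      have h3 : e x m hx = inv (e m y hy ≫ whol c e d) := by
        rw [← cancel_mono (e m y hy ≫ whol c e d), this]; simp
      rw [h3, ← Category.assoc]; simp
  apply key _ rfl
  obtain ⟨m1, m2⟩ := m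
  obtain ⟨x1, x2⟩ := x
  obtain ⟨y1, y2⟩ := y
  have h1 := adj_cases hx3.le
  have h2 := adj_cases hy3.le
  have h3 := hx.ne
  have h4 := hy.ne
  simp only [ne_eq, Prod.mk.injEq] at *
  omega
theorem convex_htpy {U C : Set ℂ} (hC : Convex ℝ C) (hCU : C ⊆ U) {a b : U} (p q : Path a b)
    (hp : ∀ t, (p t : ℂ) ∈ C) (hq : ∀ t, (q t : ℂ) ∈ C) : p.Homotopic q := by
  have hm : ∀ x : unitInterval × unitInterval,
      (1 - (x.1 : ℝ)) • (p x.2 : ℂ) + (x.1 : ℝ) • (q x.2 : ℂ) ∈ C := fun x =>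
    hC (hp _) (hq _) (by have := x.1.2.2; linarith) x.1.2.1 (by ring)
  exact ⟨{ toFun := fun x => ⟨_, hCU (hm x)⟩
           continuous_toFun := by
            apply Continuous.subtype_mk
            fun_prop
           map_zero_left := fun x => by ext; simp
           map_one_left := fun x => by ext; simp
           prop' := by
            rintro t x (rfl | rfl)
            · apply Subtype.ext
              simp
              ring
            · apply Subtype.ext
              simp
              ring }⟩

open CategoryTheory

noncomputable def clsP {U : Set ℂ} {a b : U} (p : Path a b) :
    (FundamentalGroupoid.mk a) ⟶ (FundamentalGroupoid.mk b) :=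
  Path.Homotopic.Quotient.mk p

def Supp {U : Set ℂ} (C : Set ℂ) {a b : FundamentalGroupoid U} (f : a ⟶ b) : Prop :=
  ∃ p : Path a.as b.as, f = Path.Homotopic.Quotient.mk p ∧ ∀ t, (p t : ℂ) ∈ C

theorem Supp.mono {U : Set ℂ} {C D : Set ℂ} {a b : FundamentalGroupoid U} {f : a ⟶ b}
    (h : Supp C f) (hCD : C ⊆ D) : Supp D f := by
  obtain ⟨p, h1, h2⟩ := h
  exact ⟨p, h1, fun t => hCD (h2 t)⟩

theorem Supp.comp {U : Set ℂ} {C : Set ℂ} {a b c : FundamentalGroupoid U} {f : a ⟶ b} {g : b ⟶ c}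
    (hf : Supp C f) (hg : Supp C g) : Supp C (f ≫ g) := by
  obtain ⟨p, rfl, h2⟩ := hf
  obtain ⟨q, rfl, h4⟩ := hg
  refine ⟨p.trans q, ?_, ?_⟩
  · rw [FundamentalGroupoid.comp_eq, Path.Homotopic.Quotient.mk_trans]
  · intro t
    have : (p.trans q) t ∈ Set.range (p.trans q) := ⟨t, rfl⟩
    rw [Path.trans_range] at this
    rcases this with ⟨s, hs⟩ | ⟨s, hs⟩
    · rw [← hs]; exact h2 s
    · rw [← hs]; exact h4 s

theorem Supp.id {U : Set ℂ} {C : Set ℂ} {a : FundamentalGroupoid U} (h : (a.as : ℂ) ∈ C) :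
    Supp C (𝟙 a) := ⟨Path.refl _, rfl, fun _ => h⟩

theorem Supp.eq {U : Set ℂ} {C : Set ℂ} (hC : Convex ℝ C) (hCU : C ⊆ U)
    {a b : FundamentalGroupoid U} {f g : a ⟶ b} (hf : Supp C f) (hg : Supp C g) : f = g := by
  obtain ⟨p, rfl, h2⟩ := hf
  obtain ⟨q, rfl, h4⟩ := hg
  exact Path.Homotopic.Quotient.eq.2 (convex_htpy hC hCU p q h2 h4)

theorem exists_supp {U : Set ℂ} {C : Set ℂ} (hC : Convex ℝ C) (hCU : C ⊆ U)
    (a b : FundamentalGroupoid U) (ha : (a.as : ℂ) ∈ C) (hb : (b.as : ℂ) ∈ C) :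
    ∃ f : a ⟶ b, Supp C f := by
  have hm : ∀ x : unitInterval,
      (1 - (x : ℝ)) • (a.as : ℂ) + (x : ℝ) • (b.as : ℂ) ∈ C := fun x =>
    hC ha hb (by have := x.2.2; linarith) x.2.1 (by ring)
  exact ⟨Path.Homotopic.Quotient.mk
    { toFun := fun x => ⟨_, hCU (hm x)⟩
      continuous_toFun := by
        apply Continuous.subtype_mk
        fun_prop
      source' := by ext; simp
      target' := by ext; simp }, _, rfl, hm⟩

def lbox (δ : ℝ) (v : ℤ × ℤ) : Set ℂ := {z | |z.re - δ * v.1| < 2 * δ ∧ |z.im - δ * v.2| < 2 * δ}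

theorem convex_lbox (δ : ℝ) (v : ℤ × ℤ) : Convex ℝ (lbox δ v) := by
  intro x hx y hy a b ha hb hab
  simp only [lbox, Set.mem_ofPred_eq, abs_lt, Complex.add_re, Complex.add_im, Complex.real_smul,
    Complex.mul_re, Complex.mul_im, Complex.ofReal_re, Complex.ofReal_im] at *
  obtain ⟨⟨h1, h2⟩, h3, h4⟩ := hx
  obtain ⟨⟨k1, k2⟩, k3, k4⟩ := hy
  have key : ∀ s t c d : ℝ, c < s → c < t → s < d → t < d → c < a * s + b * t ∧ a * s + b * t < d := by
    intro s t c d q1 q2 q3 q4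
    have : b = 1 - a := by linarith
    subst this
    rcases eq_or_lt_of_le ha with rfl | ha
    · constructor <;> linarith
    · constructor <;> nlinarith
  have := key x.re y.re (δ * v.1 - 2 * δ) (δ * v.1 + 2 * δ)
    (by linarith) (by linarith) (by linarith) (by linarith)
  have := key x.im y.im (δ * v.2 - 2 * δ) (δ * v.2 + 2 * δ)
    (by linarith) (by linarith) (by linarith) (by linarith)
  refine ⟨⟨?_, ?_⟩, ?_, ?_⟩ <;> linarith

def lctr (δ : ℝ) (v : ℤ × ℤ) : ℂ := ⟨δ * v.1, δ * v.2⟩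

theorem lctr_mem {δ : ℝ} (hδ : 0 < δ) {u v : ℤ × ℤ} (h1 : |u.1 - v.1| ≤ 1) (h2 : |u.2 - v.2| ≤ 1) :
    lctr δ u ∈ lbox δ v := by
  have key : ∀ a b : ℤ, |a - b| ≤ 1 → |δ * a - δ * b| < 2 * δ := by
    intro a b h
    rw [← mul_sub, abs_mul, abs_of_pos hδ]
    have : |(a:ℝ) - b| ≤ 1 := by exact_mod_cast h
    nlinarith
  exact ⟨key _ _ h1, key _ _ h2⟩

noncomputable def lfl (δ : ℝ) (z : ℂ) : ℤ × ℤ := (⌊z.re / δ⌋, ⌊z.im / δ⌋)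

theorem floor_near {δ : ℝ} (hδ : 0 < δ) {x y : ℝ} (h : |x - y| < δ) :
    |⌊x / δ⌋ - ⌊y / δ⌋| ≤ 1 := by
  have h1 : |x / δ - y / δ| < 1 := by
    rw [← sub_div, abs_div, abs_of_pos hδ, div_lt_one hδ]; exact h
  rw [abs_lt] at h1
  rw [abs_le]
  have := Int.floor_le (x / δ)
  have := Int.lt_floor_add_one (x / δ)
  have := Int.floor_le (y / δ)
  have := Int.lt_floor_add_one (y / δ)
  constructor
  · have : ((⌊y / δ⌋ : ℤ) : ℝ) < (⌊x / δ⌋ + 2 : ℤ) := by push_cast; linarith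
    have := Int.cast_lt.1 this
    omega
  · have : ((⌊x / δ⌋ : ℤ) : ℝ) < (⌊y / δ⌋ + 2 : ℤ) := by push_cast; linarith
    have := Int.cast_lt.1 this
    omega

theorem floor_bd {δ : ℝ} (hδ : 0 < δ) (x : ℝ) : δ * ⌊x / δ⌋ ≤ x ∧ x < δ * ⌊x / δ⌋ + δ := by
  have h1 := Int.floor_le (x / δ)
  have h2 := Int.lt_floor_add_one (x / δ)
  rw [le_div_iff₀ hδ] at h1
  rw [div_lt_iff₀ hδ] at h2
  constructor <;> linarith

theorem lfl_mem {δ : ℝ} (hδ : 0 < δ) {z : ℂ} {v : ℤ × ℤ} (h1 : |v.1 - (lfl δ z).1| ≤ 1)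
    (h2 : |v.2 - (lfl δ z).2| ≤ 1) : z ∈ lbox δ v := by
  have key : ∀ (x : ℝ) (a : ℤ), |a - ⌊x / δ⌋| ≤ 1 → |x - δ * a| < 2 * δ := by
    intro x a h
    have := floor_bd hδ x
    have h : |(a:ℝ) - ⌊x / δ⌋| ≤ 1 := by exact_mod_cast h
    rw [abs_le] at h
    rw [abs_lt]
    constructor <;> nlinarith
  exact ⟨key _ _ h1, key _ _ h2⟩

theorem lbox_near {δ : ℝ} (hδ : 0 < δ) {z w : ℂ} (h : dist z w < δ) : w ∈ lbox δ (lfl δ z) := by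
  have h1 := (Complex.abs_re_le_norm (z - w)).trans_lt (by rwa [dist_eq_norm] at h)
  have h2 := (Complex.abs_im_le_norm (z - w)).trans_lt (by rwa [dist_eq_norm] at h)
  have h3 := floor_bd hδ z.re
  have h4 := floor_bd hδ z.im
  simp only [Complex.sub_re, Complex.sub_im, abs_lt] at h1 h2
  simp only [lbox, lfl, Set.mem_ofPred_eq, abs_lt]
  refine ⟨⟨?_, ?_⟩, ?_, ?_⟩ <;> linarith
theorem main_disc {U : Set ℂ} {δ : ℝ} (hδ : 0 < δ) (M : ℤ) (Free : ℤ × ℤ → Prop)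
    (hbox : ∀ v, ¬ LBad M Free v → lbox δ v ⊆ U) (γ : C(unitInterval, U)) (h01 : γ 1 = γ 0)
    (N : ℕ) (hN : 0 < N) (hstep : ∀ s t : unitInterval, dist s t ≤ 1 / N → dist (γ s) (γ t) < δ)
    (hfree : ∀ v t, (γ t : ℂ) ∈ lbox δ v → ¬ LBad M Free v) :
    ∃ q : Path (γ 0) (γ 0), (∀ t, q t = γ t) ∧ q.Homotopic (Path.refl _) := by
  classical
  set G := latG (fun v => ¬ LBad M Free v) with hG
  have hctr : ∀ v, ¬ LBad M Free v → lctr δ v ∈ U := fun v hv =>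
    hbox v hv (lctr_mem hδ (by simp) (by simp))
  let c : ℤ × ℤ → FundamentalGroupoid U := fun v =>
    if h : ¬ LBad M Free v then ⟨⟨lctr δ v, hctr v h⟩⟩ else ⟨γ 0⟩
  have hc : ∀ v, ¬ LBad M Free v → ((c v).as : ℂ) = lctr δ v := by
    intro v hv
    simp only [c, dif_pos hv]
  have hcm : ∀ u v, ¬ LBad M Free u → |u.1 - v.1| ≤ 1 → |u.2 - v.2| ≤ 1 →
      ((c u).as : ℂ) ∈ lbox δ v := by
    intro u v hu h1 h2
    rw [hc u hu]; exact lctr_mem hδ h1 h2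
  have habs : ∀ a b : ℤ, |a| + |b| = 1 → |a| ≤ 1 ∧ |b| ≤ 1 := by
    intro a b h
    have := abs_nonneg a
    have := abs_nonneg b
    omega
  have hex : ∀ u v (h : G.Adj u v), ∃ f : c u ⟶ c v,
      Supp (segment ℝ ((c u).as : ℂ) ((c v).as : ℂ)) f := by
    intro u v h
    refine exists_supp (convex_segment _ _) ?_ _ _ (left_mem_segment _ _ _)
      (right_mem_segment _ _ _)
    refine subset_trans ?_ (hbox u h.1)
    have := habs _ _ h.symm.2.2
    exact (convex_lbox δ u).segment_subset (hcm u u h.1 (by simp) (by simp))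
      (hcm v u h.2.1 this.1 this.2)
  choose e he using hex
  have he' : ∀ u v (h : G.Adj u v) w, |u.1 - w.1| ≤ 1 → |u.2 - w.2| ≤ 1 → |v.1 - w.1| ≤ 1 →
      |v.2 - w.2| ≤ 1 → Supp (lbox δ w) (e u v h) := by
    intro u v h w h1 h2 h3 h4
    exact (he u v h).mono ((convex_lbox δ w).segment_subset (hcm u w h.1 h1 h2)
      (hcm v w h.2.1 h3 h4))
  have heq : ∀ w, ¬ LBad M Free w → ∀ {a b : FundamentalGroupoid U} {f g : a ⟶ b},
      Supp (lbox δ w) f → Supp (lbox δ w) g → f = g := fun w hw _ _ _ _ hf hg =>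
    Supp.eq (convex_lbox δ w) (hbox w hw) hf hg
  have triv := whol_trivial M Free c e
    (by
      intro u v h
      have h1 := habs _ _ h.2.2
      have h2 := habs _ _ h.symm.2.2
      refine heq u h.1 (Supp.comp (he' _ _ h u (by simp) (by simp) h2.1 h2.2)
        (he' _ _ h.symm u h2.1 h2.2 (by simp) (by simp))) (Supp.id (hcm u u h.1 (by simp) (by simp))))
    (by
      intro u v w z h1 h2 h3 h4 h5 h6
      have k1 := habs _ _ h1.2.2
      have k2 := habs _ _ h2.symm.2.2
      rw [abs_sub_comm] at h5 h6
      exact heq v h1.2.1 (Supp.comp (he' _ _ h1 v k1.1 k1.2 (by simp) (by simp))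
        (he' _ _ h2 v (by simp) (by simp) k2.1 k2.2))
        (Supp.comp (he' _ _ h3 v k1.1 k1.2 h5 h6) (he' _ _ h4 v h5 h6 k2.1 k2.2)))
  -- short walks
  have hshort1 : ∀ u v w, ¬ LBad M Free u → ¬ LBad M Free v → |u.1 - v.1| + |u.2 - v.2| ≤ 1 →
      |u.1 - w.1| ≤ 1 → |u.2 - w.2| ≤ 1 → |v.1 - w.1| ≤ 1 → |v.2 - w.2| ≤ 1 →
      ∃ q : G.Walk u v, Supp (lbox δ w) (whol c e q) := by
    intro u v w hu hv huv h1 h2 h3 h4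
    rcases huv.lt_or_eq with h | h
    · have : u = v := by
        have := abs_nonneg (u.1 - v.1)
        have := abs_nonneg (u.2 - v.2)
        have k1 : |u.1 - v.1| = 0 := by omega
        have k2 : |u.2 - v.2| = 0 := by omega
        rw [abs_eq_zero, sub_eq_zero] at k1 k2
        exact Prod.ext k1 k2
      subst this
      exact ⟨.nil, Supp.id (hcm _ _ hu h1 h2)⟩
    · have hadj : G.Adj u v := ⟨hu, hv, h⟩
      refine ⟨.cons hadj .nil, ?_⟩
      simpa [whol] using he' u v hadj w h1 h2 h3 h4
  have hshort : ∀ u v, ¬ LBad M Free u → ¬ LBad M Free v → ¬ LBad M Free (v.1, u.2) →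
      |v.1 - u.1| ≤ 1 → |v.2 - u.2| ≤ 1 → ∃ q : G.Walk u v, Supp (lbox δ u) (whol c e q) := by
    intro u v hu hv hm h1 h2
    obtain ⟨q1, hq1⟩ := hshort1 u (v.1, u.2) u hu hm
      (by rw [abs_sub_comm] at h1; simpa using h1) (by simp) (by simp) h1 (by simp)
    obtain ⟨q2, hq2⟩ := hshort1 (v.1, u.2) v u hm hv
      (by rw [abs_sub_comm] at h2; simpa using h2) h1 (by simp) h1 h2
    refine ⟨q1.append q2, ?_⟩
    rw [whol_append]; exact hq1.comp hq2
  let P : Path (γ 0) (γ 1) := ⟨γ, rfl, rfl⟩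
  let t : ℕ → unitInterval := fun k => Set.projIcc 0 1 zero_le_one ((k : ℝ) / N)
  have ht0 : t 0 = 0 := by simp [t]
  have htN : t N = 1 := by
    have : (N : ℝ) / N = 1 := div_self (by positivity)
    simp [t, this]
  have htk : ∀ k, dist (t k) (t (k + 1)) ≤ 1 / N := by
    intro k
    have h1 := Set.abs_projIcc_sub_projIcc (a := (0:ℝ)) (b := 1) (c := (k : ℝ) / N)
      (d := ((k + 1 : ℕ) : ℝ) / N) zero_le_one
    rw [Subtype.dist_eq, Real.dist_eq]
    refine h1.trans ?_
    rw [← sub_div]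
    push_cast
    simp [abs_div]
  let v : unitInterval → ℤ × ℤ := fun s => lfl δ (γ s)
  have hv : ∀ s w, |w.1 - (v s).1| ≤ 1 → |w.2 - (v s).2| ≤ 1 → ¬ LBad M Free w := by
    intro s w h1 h2
    exact hfree w s (lfl_mem hδ h1 h2)
  have hvs : ∀ s, ¬ LBad M Free (v s) := fun s => hv s _ (by simp) (by simp)
  have hself : ∀ s, (γ s : ℂ) ∈ lbox δ (v s) := fun s => lfl_mem hδ (by simp [v]) (by simp [v])
  have hσ : ∀ s, ∃ σ : (⟨γ s⟩ : FundamentalGroupoid U) ⟶ c (v s), Supp (lbox δ (v s)) σ := by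
    intro s
    exact exists_supp (convex_lbox _ _) (hbox _ (hvs s)) _ _ (hself s)
      (hcm _ _ (hvs s) (by simp) (by simp))
  obtain ⟨σ0, hσ0⟩ := hσ 0
  have main : ∀ k, ∀ σ : (⟨γ (t k)⟩ : FundamentalGroupoid U) ⟶ c (v (t k)),
      Supp (lbox δ (v (t k))) σ → ∃ w : G.Walk (v 0) (v (t k)),
      (clsP (P.subpath 0 (t k))) ≫ σ = σ0 ≫ whol c e w := by
    intro k
    induction k with
    | zero =>
      rw [ht0]
      intro σ hs
      refine ⟨.nil, ?_⟩
      rw [heq _ (hvs 0) hs hσ0]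
      rw [Path.subpath_self]
      simp only [whol, Category.comp_id]
      exact Category.id_comp _
    | succ k ih =>
      intro σ' hs'
      obtain ⟨σ, hs⟩ := hσ (t k)
      obtain ⟨w, hw⟩ := ih σ hs
      have hd := hstep _ _ (htk k)
      rw [Subtype.dist_eq] at hd
      have hre : |(v (t (k+1))).1 - (v (t k)).1| ≤ 1 := by
        apply floor_near hδ
        rw [← Complex.sub_re]
        rw [dist_comm] at hd
        exact (Complex.abs_re_le_norm _).trans_lt (by rwa [dist_eq_norm] at hd)
      have him : |(v (t (k+1))).2 - (v (t k)).2| ≤ 1 := by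
        apply floor_near hδ
        rw [← Complex.sub_im]
        rw [dist_comm] at hd
        exact (Complex.abs_im_le_norm _).trans_lt (by rwa [dist_eq_norm] at hd)
      obtain ⟨q, hq⟩ := hshort (v (t k)) (v (t (k+1))) (hvs _) (hvs _)
        (hv (t k) _ hre (by simp)) hre him
      refine ⟨w.append q, ?_⟩
      have hP : (clsP (P.subpath 0 (t (k+1)))) =
          (clsP (P.subpath 0 (t k))) ≫
          (clsP (P.subpath (t k) (t (k+1)))) := by
        rw [FundamentalGroupoid.comp_eq, clsP, clsP, clsP, ← Path.Homotopic.Quotient.mk_trans]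
        exact (Path.Homotopic.Quotient.eq.2 ⟨Path.Homotopy.subpathTransSubpath P _ _ _⟩).symm
      have hr : Supp (lbox δ (v (t k))) (clsP (P.subpath (t k) (t (k+1)))) := by
        refine ⟨P.subpath (t k) (t (k+1)), rfl, ?_⟩
        intro s
        have : (P.subpath (t k) (t (k+1))) s ∈ Set.range (P.subpath (t k) (t (k+1))) := ⟨s, rfl⟩
        rw [Path.range_subpath] at this
        obtain ⟨s', hs', hss⟩ := this
        rw [← hss]
        apply lbox_near hδ
        have : dist (t k) s' ≤ 1 / N := by
          refine le_trans ?_ (htk k)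
          rw [Subtype.dist_eq, Subtype.dist_eq]
          apply Real.dist_left_le_of_mem_uIcc
          rcases le_total (t k) (t (k+1)) with h | h
          · rw [Set.uIcc_of_le h] at hs'
            rw [Set.uIcc_of_le (by exact_mod_cast h)]
            exact ⟨by exact_mod_cast hs'.1, by exact_mod_cast hs'.2⟩
          · rw [Set.uIcc_of_ge h] at hs'
            rw [Set.uIcc_of_ge (by exact_mod_cast h)]
            exact ⟨by exact_mod_cast hs'.1, by exact_mod_cast hs'.2⟩
        exact hstep _ _ this
      -- last leg
      obtain ⟨τ, hτ⟩ : ∃ τ : (⟨γ (t (k+1))⟩ : FundamentalGroupoid U) ⟶ c (v (t (k+1))),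
          Supp (lbox δ (v (t k)) ∩ lbox δ (v (t (k+1)))) τ := by
        refine exists_supp ((convex_lbox _ _).inter (convex_lbox _ _))
          (inter_subset_left.trans (hbox _ (hvs _))) _ _ ⟨lbox_near hδ hd, hself _⟩
          ⟨hcm _ _ (hvs _) hre him, hcm _ _ (hvs _) (by simp) (by simp)⟩
      rw [heq _ (hvs _) hs' (hτ.mono inter_subset_right)]
      rw [hP, whol_append, Category.assoc, ← Category.assoc σ0, ← hw, Category.assoc]
      congr 1
      exact heq _ (hvs (t k)) (hr.comp (hτ.mono inter_subset_left)) (hs.comp hq)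
  have fin : ∀ (y : U) (hy : y = γ 0) (p : Path (γ 0) y),
      (∀ σ : (⟨y⟩ : FundamentalGroupoid U) ⟶ c (v 0), Supp (lbox δ (v 0)) σ →
        (clsP p) ≫ σ = σ0) →
      (∀ s, p s = γ s) →
      ∃ q : Path (γ 0) (γ 0), (∀ t, q t = γ t) ∧ q.Homotopic (Path.refl _) := by
    intro y hy p hp hps
    subst hy
    refine ⟨p, hps, ?_⟩
    have h1 := hp σ0 hσ0
    have h2 : (clsP p) = 𝟙 _ := by
      rw [← cancel_mono σ0, h1]; simp
    exact Path.Homotopic.Quotient.exact h2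
  refine fin (γ 1) h01 P ?_ (fun _ => rfl)
  have hM := main N
  rw [htN] at hM
  have hv1 : v 1 = v 0 := by simp only [v, h01]
  rw [hv1] at hM
  intro σ hs
  obtain ⟨w, hw⟩ := hM σ hs
  rw [triv _ _ _ w rfl rfl, Category.comp_id] at hw
  rw [← hw]
  congr 2
  rw [Path.subpath_zero_one]
  rfl
theorem LBad.block {M : ℤ} {Free : ℤ × ℤ → Prop} (a1 a2 b1 b2 : ℤ)
    (hf : ∀ u : ℤ × ℤ, a1 ≤ u.1 → u.1 ≤ a2 → b1 ≤ u.2 → u.2 ≤ b2 → Free u)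
    (w : ℤ × ℤ) (hw : LBad M Free w) (w1 : a1 ≤ w.1) (w2 : w.1 ≤ a2) (w3 : b1 ≤ w.2)
    (w4 : w.2 ≤ b2) :
    ∀ (n : ℕ) (v : ℤ × ℤ), a1 ≤ v.1 → v.1 ≤ a2 → b1 ≤ v.2 → v.2 ≤ b2 →
      (v.1 - w.1).natAbs + (v.2 - w.2).natAbs = n → LBad M Free v := by
  intro n
  induction n with
  | zero =>
    intro v _ _ _ _ h
    have : v = w := Prod.ext (by omega) (by omega)
    rw [this]; exact hw
  | succ n ih =>
    intro v v1 v2 v3 v4 h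
    have hfv := hf v v1 v2 v3 v4
    obtain ⟨x, y⟩ := v
    simp only at *
    rcases lt_trichotomy x w.1 with hx | hx | hx
    · exact .step _ (x + 1, y) hfv (by simp)
        (ih _ (by simp; omega) (by simp; omega) (by simp; omega) (by simp; omega)
          (by simp only; omega))
    · rcases lt_trichotomy y w.2 with hy | hy | hy
      · exact .step _ (x, y + 1) hfv (by simp)
          (ih _ (by simp; omega) (by simp; omega) (by simp; omega) (by simp; omega)
            (by simp only; omega))
      · omega
      · exact .step _ (x, y - 1) hfv (by simp)
          (ih _ (by simp; omega) (by simp; omega) (by simp; omega) (by simp; omega)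
            (by simp only; omega))
    · exact .step _ (x - 1, y) hfv (by simp)
        (ih _ (by simp; omega) (by simp; omega) (by simp; omega) (by simp; omega)
          (by simp only; omega))

theorem LBad.near {K : Set ℂ} {δ ε : ℝ} (hδ : 0 < δ) (hε : 12 * δ ≤ ε) {M : ℤ} {z : ℂ}
    (hz : ∀ k ∈ K, ε ≤ dist z k) {v w : ℤ × ℤ}
    (hw : LBad M (fun v => ∀ k ∈ K, k ∉ lbox δ v) w)
    (h1 : |w.1 - (lfl δ z).1| ≤ 3) (h2 : |w.2 - (lfl δ z).2| ≤ 3)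
    (h3 : |v.1 - (lfl δ z).1| ≤ 3) (h4 : |v.2 - (lfl δ z).2| ≤ 3) :
    LBad M (fun v => ∀ k ∈ K, k ∉ lbox δ v) v := by
  rw [abs_le] at h1 h2 h3 h4
  refine LBad.block ((lfl δ z).1 - 3) ((lfl δ z).1 + 3) ((lfl δ z).2 - 3) ((lfl δ z).2 + 3) ?_ w hw
    (by omega) (by omega) (by omega) (by omega) _ v (by omega) (by omega) (by omega) (by omega) rfl
  intro u u1 u2 u3 u4 k hk hku
  have key : ∀ (x y : ℝ) (a : ℤ), ⌊x / δ⌋ - 3 ≤ a → a ≤ ⌊x / δ⌋ + 3 → |y - δ * a| < 2 * δ →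
      |x - y| < 6 * δ := by
    intro x y a h1 h2 h3
    have := floor_bd hδ x
    have h1 : (⌊x / δ⌋ : ℝ) - 3 ≤ a := by exact_mod_cast h1
    have h2 : (a : ℝ) ≤ ⌊x / δ⌋ + 3 := by exact_mod_cast h2
    rw [abs_lt] at *
    constructor <;> nlinarith
  have e1 := key z.re k.re u.1 u1 u2 hku.1
  have e2 := key z.im k.im u.2 u3 u4 hku.2
  have := hz k hk
  rw [dist_eq_norm] at this
  have h := Complex.norm_le_abs_re_add_abs_im (z - k)
  simp only [Complex.sub_re, Complex.sub_im] at h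
  linarith

theorem LBad.conn {K : Set ℂ} {δ ε : ℝ} (hδ : 0 < δ) (hε : 12 * δ ≤ ε) {M : ℤ} {S : Set ℂ}
    (hS : IsPreconnected S)
    (hSK : ∀ z ∈ S, ∀ k ∈ K, ε ≤ dist z k) {w : ℂ} (hwS : w ∈ S)
    (hw : LBad M (fun v => ∀ k ∈ K, k ∉ lbox δ v) (lfl δ w)) {z : ℂ} (hz : z ∈ S) :
    LBad M (fun v => ∀ k ∈ K, k ∉ lbox δ v) (lfl δ z) := by
  by_contra hzb
  set B := fun z => LBad M (fun v => ∀ k ∈ K, k ∉ lbox δ v) (lfl δ z) with hB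
  have hloc : ∀ a ∈ S, ∀ b ∈ S, dist a b < δ → B a → B b := by
    intro a ha b hb hab hBa
    rw [dist_eq_norm] at hab
    have h1 := floor_near hδ ((Complex.sub_re a b ▸ Complex.abs_re_le_norm (a - b)).trans_lt hab)
    have h2 := floor_near hδ ((Complex.sub_im a b ▸ Complex.abs_im_le_norm (a - b)).trans_lt hab)
    exact LBad.near hδ hε (hSK b hb) hBa (h1.trans (by norm_num)) (h2.trans (by norm_num))
      (by simp) (by simp)
  obtain ⟨x, hxS, hx1, hx2⟩ := hS (⋃ a ∈ {a ∈ S | B a}, Metric.ball a δ)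
    (⋃ a ∈ {a ∈ S | ¬ B a}, Metric.ball a δ)
    (isOpen_biUnion fun _ _ => Metric.isOpen_ball) (isOpen_biUnion fun _ _ => Metric.isOpen_ball)
    (by
      intro x hx
      by_cases hb : B x
      · exact Or.inl (mem_biUnion (⟨hx, hb⟩ : x ∈ {a ∈ S | B a}) (Metric.mem_ball_self hδ))
      · exact Or.inr (mem_biUnion (⟨hx, hb⟩ : x ∈ {a ∈ S | ¬ B a}) (Metric.mem_ball_self hδ)))
    ⟨w, hwS, mem_biUnion (⟨hwS, hw⟩ : w ∈ {a ∈ S | B a}) (Metric.mem_ball_self hδ)⟩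
    ⟨z, hz, mem_biUnion (⟨hz, hzb⟩ : z ∈ {a ∈ S | ¬ B a}) (Metric.mem_ball_self hδ)⟩
  simp only [mem_iUnion] at hx1 hx2
  obtain ⟨a, ⟨haS, hBa⟩, hxa⟩ := hx1
  obtain ⟨b, ⟨hbS, hBb⟩, hxb⟩ := hx2
  rw [Metric.mem_ball] at hxa hxb
  exact hBb (hloc x hxS b hbS hxb (hloc a haS x hxS (by rwa [dist_comm]) hBa))

theorem exists_eps {U K : Set ℂ} (hU : IsOpen U) (hK : IsCompact K) (hKU : K ⊆ U)
    (hbdd : ∀ C : Set ℂ, (∃ x ∈ Kᶜ, C = connectedComponentIn Kᶜ x) →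
      Bornology.IsBounded C → C ⊆ U) (R : ℝ) :
    ∃ ε > 0, ∀ z ∈ Uᶜ ∩ Metric.closedBall 0 R, ∃ S : Set ℂ, IsPreconnected S ∧ z ∈ S ∧
      (∀ w ∈ S, ∀ k ∈ K, ε ≤ dist w k) ∧ ∃ w ∈ S, R < ‖w‖ := by
  have hcomp : IsCompact (Uᶜ ∩ Metric.closedBall (0:ℂ) R) :=
    (isCompact_closedBall 0 R).inter_left hU.isClosed_compl
  refine hcomp.induction_on
    (p := fun s => ∃ ε > 0, ∀ z ∈ s, ∃ S : Set ℂ, IsPreconnected S ∧ z ∈ S ∧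
      (∀ w ∈ S, ∀ k ∈ K, ε ≤ dist w k) ∧ ∃ w ∈ S, R < ‖w‖) ⟨1, one_pos, by simp⟩ ?_ ?_ ?_
  · rintro s t hst ⟨ε, hε, h⟩
    exact ⟨ε, hε, fun z hz => h z (hst hz)⟩
  · rintro s t ⟨ε, hε, h⟩ ⟨ε', hε', h'⟩
    refine ⟨min ε ε', lt_min hε hε', ?_⟩
    rintro z (hz | hz)
    · obtain ⟨S, h1, h2, h3, h4⟩ := h z hz
      exact ⟨S, h1, h2, fun w hw k hk => (min_le_left _ _).trans (h3 w hw k hk), h4⟩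
    · obtain ⟨S, h1, h2, h3, h4⟩ := h' z hz
      exact ⟨S, h1, h2, fun w hw k hk => (min_le_right _ _).trans (h3 w hw k hk), h4⟩
  · rintro z ⟨hzU, -⟩
    have hzK : z ∈ Kᶜ := fun h => hzU (hKU h)
    set Z := connectedComponentIn Kᶜ z with hZ
    have hZo : IsOpen Z := hK.isClosed.isOpen_compl.connectedComponentIn
    have hZc : IsConnected Z := isConnected_connectedComponentIn_iff.2 hzK
    have hzZ : z ∈ Z := mem_connectedComponentIn hzK
    have hnb : ¬ Bornology.IsBounded Z := fun hb => hzU (hbdd Z ⟨z, hzK, rfl⟩ hb hzZ)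
    obtain ⟨w, hwZ, hwR⟩ : ∃ w ∈ Z, R < ‖w‖ := by
      by_contra hcon
      push Not at hcon
      exact hnb (isBounded_iff_forall_norm_le.2 ⟨R, hcon⟩)
    obtain ⟨p, hp⟩ := ((hZo.isConnected_iff_isPathConnected).1 hZc).joinedIn z hzZ w hwZ
    have hcr : IsCompact (Set.range p) := isCompact_range p.continuous
    have hdis : Disjoint (Set.range p) K := by
      rw [Set.disjoint_left]
      rintro _ ⟨s, rfl⟩
      exact connectedComponentIn_subset _ _ (hp s)
    obtain ⟨r, hr, hrd⟩ := hdis.exists_thickenings hcr hK.isClosed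
    refine ⟨Metric.ball z r, mem_nhdsWithin_of_mem_nhds (Metric.ball_mem_nhds z hr), r, hr, ?_⟩
    intro z' hz'
    refine ⟨Metric.ball z r ∪ Set.range p, ?_, Or.inl hz', ?_, w, Or.inr ⟨1, p.target⟩, hwR⟩
    · exact IsPreconnected.union z (Metric.mem_ball_self hr) ⟨0, p.source⟩
        (convex_ball z r).isPreconnected (isPreconnected_range p.continuous)
    · intro x hx k hk
      by_contra hlt
      push Not at hlt
      refine (Set.disjoint_left.1 hrd) (?_ : x ∈ _) (Metric.mem_thickening_iff.2 ⟨k, hk, hlt⟩)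
      rcases hx with hx | hx
      · exact Metric.mem_thickening_iff.2 ⟨z, ⟨0, p.source⟩, hx⟩
      · exact Metric.self_subset_thickening hr _ hx

theorem lfl_far {δ R : ℝ} (hδ : 0 < δ) (hδ1 : δ ≤ 1) {M : ℤ} (hM : δ * M ≤ R + 3 * δ) {w : ℂ}
    (hw : 2 * R + 8 < ‖w‖) : M < |(lfl δ w).1| ∨ M < |(lfl δ w).2| := by
  have key : ∀ x : ℝ, R + 4 < |x| → M < |⌊x / δ⌋| := by
    intro x hx
    have h := floor_bd hδ x
    have : (M : ℝ) < |(⌊x / δ⌋ : ℝ)| := by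
      by_contra hcon
      push Not at hcon
      rw [abs_le] at hcon
      rcases abs_cases x with h' | h' <;> nlinarith
    exact_mod_cast this
  have h := Complex.norm_le_abs_re_add_abs_im w
  by_cases h1 : R + 4 < |w.re|
  · exact Or.inl (key _ h1)
  · exact Or.inr (key _ (by linarith))

theorem stmt5 (U : Set ℂ) (hU : IsOpen U) (γ : ℝ → ℂ) (hγ : IsJordanLoop γ)
    (him : γ '' Set.Icc 0 1 ⊆ U)
    (hbdd : ∀ C : Set ℂ,
      (∃ x ∈ (γ '' Set.Icc 0 1)ᶜ, C = connectedComponentIn (γ '' Set.Icc 0 1)ᶜ x) →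
      Bornology.IsBounded C → C ⊆ U) :
    ∃ H : ℝ × ℝ → ℂ,
      ContinuousOn H (Set.Icc 0 1 ×ˢ Set.Icc 0 1) ∧
      (∀ p ∈ Set.Icc (0:ℝ) 1 ×ˢ Set.Icc (0:ℝ) 1, H p ∈ U) ∧
      (∀ t ∈ Set.Icc (0:ℝ) 1, H (0, t) = γ t) ∧
      (∀ t ∈ Set.Icc (0:ℝ) 1, H (1, t) = γ 0) ∧
      (∀ s ∈ Set.Icc (0:ℝ) 1, H (s, 0) = H (s, 1)) := by
  obtain ⟨hcont, h01, -⟩ := hγ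
  set K := γ '' Set.Icc 0 1 with hKdef
  have hK : IsCompact K := isCompact_Icc.image_of_continuousOn hcont
  obtain ⟨R, hR⟩ := isBounded_iff_forall_norm_le.1 hK.isBounded
  obtain ⟨ε, hε, hE⟩ := exists_eps hU hK him hbdd (2 * R + 8)
  have hR0 : 0 ≤ R := (norm_nonneg _).trans (hR (γ 0) ⟨0, by simp, rfl⟩)
  set δ := min 1 ε / 12 with hδdef
  have hmin : 0 < min 1 ε := lt_min one_pos hε
  have hδ : 0 < δ := by positivity
  have hδε : 12 * δ ≤ ε := by
    have := min_le_right 1 ε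
    rw [hδdef]; linarith
  have hδ1 : 12 * δ ≤ 1 := by
    have := min_le_left 1 ε
    rw [hδdef]; linarith
  set M : ℤ := ⌈R / δ⌉ + 2 with hMdef
  have hM1 : δ * M ≤ R + 3 * δ := by
    have := Int.ceil_lt_add_one (R / δ)
    have h2 : R / δ * δ = R := by field_simp
    rw [hMdef]; push_cast
    nlinarith
  have hM2 : R + 2 * δ ≤ δ * M := by
    have := Int.le_ceil (R / δ)
    have h2 : R / δ * δ = R := by field_simp
    rw [hMdef]; push_cast
    nlinarith
  let Free : ℤ × ℤ → Prop := fun v => ∀ k ∈ K, k ∉ lbox δ v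
  have hbox : ∀ v, ¬ LBad M Free v → lbox δ v ⊆ U := by
    intro v hv z hz
    by_contra hzU
    apply hv
    obtain ⟨S, hS, hzS, hSK, w, hwS, hw⟩ : ∃ S : Set ℂ, IsPreconnected S ∧ z ∈ S ∧
      (∀ w ∈ S, ∀ k ∈ K, 12 * δ ≤ dist w k) ∧ ∃ w ∈ S, 2 * R + 8 < ‖w‖ := by
      by_cases hzR : ‖z‖ ≤ 2 * R + 8
      · obtain ⟨S, h1, h2, h3, h4⟩ := hE z ⟨hzU, by simpa using hzR⟩
        exact ⟨S, h1, h2, fun w hw k hk => hδε.trans (h3 w hw k hk), h4⟩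
      · push Not at hzR
        refine ⟨{z}, isPreconnected_singleton, rfl, ?_, z, rfl, hzR⟩
        rintro w rfl k hk
        have := hR k hk
        have := norm_sub_norm_le w k
        rw [dist_eq_norm]
        linarith
    have hb := LBad.conn (M := M) hδ le_rfl hS hSK hwS
      (.far _ (lfl_far hδ (by linarith) hM1 hw)) hzS
    have key : ∀ (x : ℝ) (a : ℤ), |x - δ * a| < 2 * δ → |a - ⌊x / δ⌋| ≤ 3 := by
      intro x a h
      have hf := floor_bd hδ x
      rw [abs_lt] at h
      have h1 : (a : ℝ) < (⌊x / δ⌋ + 3 : ℤ) := by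
        push_cast
        by_contra hc
        push Not at hc
        nlinarith
      have h2 : ((⌊x / δ⌋ - 3 : ℤ) : ℝ) < a := by
        push_cast
        by_contra hc
        push Not at hc
        nlinarith
      have h1 := Int.cast_lt.1 h1
      have h2 := Int.cast_lt.1 h2
      rw [abs_le]; omega
    exact LBad.near hδ le_rfl (hSK z hzS) hb (by simp) (by simp) (key _ _ hz.1) (key _ _ hz.2)
  -- the loop in the subtype
  have hmem : ∀ s : unitInterval, γ s ∈ U := fun s => him ⟨s, s.2, rfl⟩
  let g : C(unitInterval, U) := ⟨fun s => ⟨γ s, hmem s⟩,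
    Continuous.subtype_mk (continuousOn_iff_continuous_domRestrict.1 hcont) _⟩
  have hgv : ∀ s, (g s : ℂ) = γ s := fun _ => rfl
  have hg01 : g 1 = g 0 := by
    apply Subtype.ext
    rw [hgv, hgv]; simp [h01]
  obtain ⟨η, hη, hunif⟩ := Metric.uniformContinuous_iff.1
    (CompactSpace.uniformContinuous_of_continuous g.continuous) δ hδ
  obtain ⟨n, hn⟩ := exists_nat_one_div_lt hη
  obtain ⟨q, hq, hqr⟩ := main_disc hδ M Free hbox g hg01 (n + 1) (Nat.succ_pos n)
    (by
      intro s t hst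
      apply hunif
      push_cast at hst
      exact hst.trans_lt hn)
    (by
      intro v s hs hbad
      have hsK : (g s : ℂ) ∈ K := ⟨s, s.2, rfl⟩
      cases hbad with
      | far _ h =>
        have hn := hR _ hsK
        have h1 := (Complex.abs_re_le_norm (g s : ℂ)).trans hn
        have h2 := (Complex.abs_im_le_norm (g s : ℂ)).trans hn
        have key : ∀ (x : ℝ) (a : ℤ), |x| ≤ R → |x - δ * a| < 2 * δ → ¬ M < |a| := by
          intro x a hx hxa hMa
          have hMa : (M : ℝ) < |(a : ℝ)| := by exact_mod_cast hMa
          rw [abs_le] at hx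
          rw [abs_lt] at hxa
          rcases abs_cases (a : ℝ) with h' | h' <;> nlinarith
        rcases h with h | h
        · exact key _ _ h1 hs.1 h
        · exact key _ _ h2 hs.2 h
      | step _ w hf _ _ => exact hf _ hsK hs)
  obtain ⟨F⟩ := hqr
  refine ⟨fun x => (F (Set.projIcc 0 1 zero_le_one x.1, Set.projIcc 0 1 zero_le_one x.2) : ℂ),
    ?_, ?_, ?_, ?_, ?_⟩
  · apply Continuous.continuousOn
    have : Continuous (Set.projIcc (0:ℝ) 1 zero_le_one) := continuous_projIcc
    fun_prop
  · intro p _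
    exact Subtype.coe_prop _
  · intro t ht
    simp only [Set.projIcc_left, Set.projIcc_of_mem _ ht]
    have := F.apply_zero ⟨t, ht⟩
    erw [this]
    exact (congrArg Subtype.val (hq ⟨t, ht⟩)).trans (hgv _)
  · intro t ht
    simp only [Set.projIcc_right, Set.projIcc_of_mem _ ht]
    have := F.apply_one ⟨t, ht⟩
    erw [this]
    exact hgv 0
  · intro s hs
    simp only [Set.projIcc_left, Set.projIcc_right]
    have h1 := F.source (Set.projIcc 0 1 zero_le_one s)
    have h2 := F.target (Set.projIcc 0 1 zero_le_one s)
    erw [h1, h2]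
end

section
/- Let A ⊆ ℂ be a nonempty compact path-connected set with 0 ∉ A which is invariant under the map z ↦ −z (that is, A = {−z : z ∈ A}). Then, regarding A as a subset of the Riemann sphere ℂ̂, the points 0 and ∞ lie in different connected components of ℂ̂ ∖ A. -/
open Set OnePoint

/-- `z ↦ z - p` has a continuous logarithm on `A`. -/
def HasLogOn9 (A : Set ℂ) (p : ℂ) : Prop :=
  ∃ f : ℂ → ℂ, ContinuousOn f A ∧ ∀ z ∈ A, Complex.exp (f z) = z - p

theorem hasLog_perturb9 (A : Set ℂ) (g₁ g₂ f : ℂ → ℂ) (hg₁ : ContinuousOn g₁ A)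
    (hg₂ : ContinuousOn g₂ A) (hf : ContinuousOn f A)
    (hfe : ∀ z ∈ A, Complex.exp (f z) = g₁ z)
    (hlt : ∀ z ∈ A, ‖g₂ z - g₁ z‖ < ‖g₁ z‖) :
    ∃ F : ℂ → ℂ, ContinuousOn F A ∧ ∀ z ∈ A, Complex.exp (F z) = g₂ z := by
  have hne : ∀ z ∈ A, g₁ z ≠ 0 := fun z hz => by
    rw [← hfe z hz]; exact Complex.exp_ne_zero _
  have hslit : ∀ z ∈ A, g₂ z / g₁ z ∈ Complex.slitPlane := by
    intro z hz
    have h1 : ‖g₂ z / g₁ z - 1‖ < 1 := by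
      have : g₂ z / g₁ z - 1 = (g₂ z - g₁ z) / g₁ z := by
        have := hne z hz
        field_simp
      rw [this, norm_div, div_lt_one (norm_pos_iff.2 (hne z hz))]
      exact hlt z hz
    left
    have h2 := Complex.abs_re_le_norm (g₂ z / g₁ z - 1)
    have h3 := (abs_lt.1 (h2.trans_lt h1)).1
    rw [Complex.sub_re, Complex.one_re] at h3
    linarith
  refine ⟨fun z => f z + Complex.log (g₂ z / g₁ z), ?_, ?_⟩
  · exact hf.add ((hg₂.div hg₁ hne).clog hslit)
  · intro z hz
    rw [Complex.exp_add, hfe z hz, Complex.exp_log (Complex.slitPlane_ne_zero (hslit z hz))]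
    have := hne z hz
    field_simp

theorem hasLog_near9 (A : Set ℂ) (p q : ℂ) (h : HasLogOn9 A p)
    (hlt : ∀ z ∈ A, ‖p - q‖ < ‖z - p‖) : HasLogOn9 A q := by
  obtain ⟨f, hf, hfe⟩ := h
  refine hasLog_perturb9 A (fun z => z - p) (fun z => z - q) f (by fun_prop) (by fun_prop) hf hfe ?_
  intro z hz
  have : z - q - (z - p) = p - q := by ring
  simpa [this] using hlt z hz

theorem hasLog_far9 (A : Set ℂ) (q : ℂ) (hlt : ∀ z ∈ A, ‖z‖ < ‖q‖) : HasLogOn9 A q := by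
  by_cases hq : q = 0
  · subst hq
    exact ⟨fun _ => 0, continuousOn_const, fun z hz =>
      absurd (hlt z hz) (by simp)⟩
  refine hasLog_perturb9 A (fun _ => -q) (fun z => z - q) (fun _ => Complex.log (-q))
    (by fun_prop) (by fun_prop) (by fun_prop)
    (fun z _ => Complex.exp_log (neg_ne_zero.2 hq)) ?_
  intro z hz
  simpa using hlt z hz

theorem not_hasLog_zero9 (A : Set ℂ) (hne : A.Nonempty) (hpre : IsPreconnected A)
    (hsymm : ∀ z ∈ A, -z ∈ A) : ¬ HasLogOn9 A 0 := by
  rintro ⟨f, hf, hfe⟩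
  have hneg : ContinuousOn (fun z => f (-z)) A :=
    hf.comp continuous_neg.continuousOn hsymm
  have hA : ∀ z ∈ A, Complex.exp (f z - f (-z)) = -1 := by
    intro z hz
    have h1 := hfe z hz
    have h2 := hfe (-z) (hsymm z hz)
    have h3 : z ≠ 0 := by
      rintro rfl
      simp at h1
    rw [Complex.exp_sub, h1, h2]
    simp only [sub_zero]
    field_simp
  have key : ∃ z ∈ A, (f z).im = (f (-z)).im := by
    obtain ⟨a, ha⟩ := hne
    have c1 : ContinuousOn (fun z => (f z).im) A := Complex.continuous_im.comp_continuousOn hf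
    have c2 : ContinuousOn (fun z => (f (-z)).im) A := Complex.continuous_im.comp_continuousOn hneg
    rcases le_total (f a).im (f (-a)).im with h | h
    · exact hpre.intermediate_value₂ ha (hsymm a ha) c1 c2 h (by simpa using h)
    · exact hpre.intermediate_value₂ (hsymm a ha) ha c1 c2 (by simpa using h) h
  obtain ⟨z, hz, him⟩ := key
  have h := hA z hz
  have h1 := congrArg Complex.re h
  rw [Complex.exp_re, Complex.sub_im, him, sub_self, Real.cos_zero, mul_one] at h1
  have := Real.exp_pos (f z - f (-z)).re
  simp only [Complex.neg_re, Complex.one_re] at h1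
  linarith

theorem near_open9 (A : Set ℂ) (hA : IsClosed A) (p : ℂ) (hp : p ∉ A) :
    ∃ r > 0, ∀ q, dist q p < r → q ∉ A ∧ (HasLogOn9 A q ↔ HasLogOn9 A p) := by
  obtain ⟨e, he, hball⟩ := Metric.isOpen_iff.1 hA.isOpen_compl p hp
  have hd : ∀ z ∈ A, e ≤ ‖z - p‖ := by
    intro z hz
    by_contra hlt
    exact hball (show z ∈ Metric.ball p e by
      rw [Metric.mem_ball, dist_eq_norm]; exact not_le.1 hlt) hz
  refine ⟨e / 2, by positivity, fun q hq => ⟨hball (by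
    rw [Metric.mem_ball]; linarith), ?_, ?_⟩⟩
  · intro h
    refine hasLog_near9 A q p h fun z hz => ?_
    rw [dist_eq_norm] at hq
    have h1 := hd z hz
    have h2 := norm_sub_le_norm_sub_add_norm_sub z q p
    linarith
  · intro h
    refine hasLog_near9 A p q h fun z hz => ?_
    rw [dist_comm, dist_eq_norm] at hq
    have h1 := hd z hz
    linarith

theorem stmt9 (A : Set ℂ) (hne : A.Nonempty) (hcomp : IsCompact A)
    (hpath : IsPathConnected A) (h0 : (0:ℂ) ∉ A)
    (hsymm : A = (fun z : ℂ => -z) '' A) :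
    (∞ : OnePoint ℂ) ∉ connectedComponentIn
      (((fun z : ℂ => (z : OnePoint ℂ)) '' A)ᶜ) (((0:ℂ) : OnePoint ℂ)) := by
  intro hinf
  have hcl : IsClosed A := hcomp.isClosed
  have hsymm' : ∀ z ∈ A, -z ∈ A := fun z hz => by
    rw [hsymm]; exact ⟨z, hz, rfl⟩
  have hnot := not_hasLog_zero9 A hne hpath.isConnected.isPreconnected hsymm'
  have oY : IsOpen {p : ℂ | p ∉ A ∧ HasLogOn9 A p} := by
    refine Metric.isOpen_iff.2 fun p hp => ?_
    obtain ⟨r, hr, h⟩ := near_open9 A hcl p hp.1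
    exact ⟨r, hr, fun q hq => ⟨(h q hq).1, (h q hq).2.2 hp.2⟩⟩
  have oN : IsOpen {p : ℂ | p ∉ A ∧ ¬ HasLogOn9 A p} := by
    refine Metric.isOpen_iff.2 fun p hp => ?_
    obtain ⟨r, hr, h⟩ := near_open9 A hcl p hp.1
    exact ⟨r, hr, fun q hq => ⟨(h q hq).1, fun hh => hp.2 ((h q hq).2.1 hh)⟩⟩
  have hT : IsOpen (((↑) : ℂ → OnePoint ℂ) '' {p : ℂ | p ∉ A ∧ ¬ HasLogOn9 A p}) :=
    OnePoint.isOpenEmbedding_coe.isOpenMap _ oN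
  set T := ((↑) : ℂ → OnePoint ℂ) '' {p : ℂ | p ∉ A ∧ ¬ HasLogOn9 A p} with hTdef
  set S := insert (∞ : OnePoint ℂ)
    (((↑) : ℂ → OnePoint ℂ) '' {p : ℂ | p ∉ A ∧ HasLogOn9 A p}) with hSdef
  have hpreS : ((↑) : ℂ → OnePoint ℂ) ⁻¹' S = {p : ℂ | p ∉ A ∧ HasLogOn9 A p} := by
    ext p
    simp [hSdef]
  have hS : IsOpen S := by
    rw [OnePoint.isOpen_iff_of_mem (mem_insert _ _), hpreS]
    refine ⟨oY.isClosed_compl, Metric.isCompact_of_isClosed_isBounded oY.isClosed_compl ?_⟩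
    obtain ⟨R, hR⟩ := hcomp.isBounded.exists_norm_le
    refine (Metric.isBounded_closedBall (x := (0:ℂ)) (r := R)).subset fun p hp => ?_
    rw [mem_closedBall_zero_iff]
    by_contra hlt
    rw [not_le] at hlt
    exact hp ⟨fun hpA => absurd (hR p hpA) (not_le.2 hlt),
      hasLog_far9 A p fun z hz => (hR z hz).trans_lt hlt⟩
  have hdisj : Disjoint T S := by
    rw [Set.disjoint_left]
    rintro _ ⟨p, hp, rfl⟩ hpS
    have : p ∈ ((↑) : ℂ → OnePoint ℂ) ⁻¹' S := hpS
    rw [hpreS] at this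
    exact hp.2 this.2
  have h0m : ((0:ℂ) : OnePoint ℂ) ∈ ((fun z : ℂ => (z : OnePoint ℂ)) '' A)ᶜ := by
    rintro ⟨z, hz, h⟩
    rw [OnePoint.coe_injective h] at hz
    exact h0 hz
  have hsub : connectedComponentIn
      (((fun z : ℂ => (z : OnePoint ℂ)) '' A)ᶜ) (((0:ℂ) : OnePoint ℂ)) ⊆ T ∪ S := by
    intro x hx
    have hx' := connectedComponentIn_subset _ _ hx
    induction x using OnePoint.rec with
    | infty => exact Or.inr (mem_insert _ _)
    | coe p =>
      have hpA : p ∉ A := fun h => hx' ⟨p, h, rfl⟩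
      by_cases hp : HasLogOn9 A p
      · exact Or.inr (mem_insert_of_mem _ ⟨p, ⟨hpA, hp⟩, rfl⟩)
      · exact Or.inl ⟨p, ⟨hpA, hp⟩, rfl⟩
  have := isPreconnected_connectedComponentIn.subset_left_of_subset_union hT hS hdisj hsub
    ⟨_, mem_connectedComponentIn h0m, ⟨0, ⟨h0, hnot⟩, rfl⟩⟩ hinf
  obtain ⟨p, _, hp⟩ := this
  exact OnePoint.coe_ne_infty p hp
end
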